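/- arXiv:2102.02869 — 4 statements merged into one kernel-verified Lean document; each statement's English description precedes it below -/
import Mathlib

section
/- Let m, n, λ, k be positive integers and r_1, …, r_k be positive integers. If (S1) 3 divides r_i·m for each i ∈ [k], (S2) 2 divides r_i·m·n for each i ∈ [k], and (S3) r_1 + r_2 + ⋯ + r_k = 3·λ·(n−1)·C(m,2), then the hypergraph λ𝒦³_{m×n} admits an (r_1,…,r_k)-factorization, i.e., its edge multiset can be partitioned into sub-hypergraphs F_1, …, F_k such that F_i is a spanning r_i-regular sub-hypergraph for each i ∈ [k]. -/
/-!
Hypergraphs are modeled with edge multisets: an edge is a multi-subset of the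
vertex set (a `Multiset V`), and the edge collection is a `Multiset (Multiset V)`.
-/

/-- The degree of a vertex `v` in the edge multiset `E`: the total number of
occurrences of `v` among all edges (counted with multiplicity). -/
def hdeg {V : Type*} [DecidableEq V] (E : Multiset (Multiset V)) (v : V) : ℕ :=
  (E.map fun e => e.count v).sum

/-- The complete 3-uniform multipartite hypergraph `𝒦³_{m×n}` on vertex set
`Fin n × Fin m` (part `i` is `{i} × Fin m`), whose edges are exactly the
multisets `{(i,j), (i,j'), (k,l)}` with `j ≠ j'` and `i ≠ k`, each with
multiplicity `1`. -/
def K3mn (n m : ℕ) : Multiset (Multiset (Fin n × Fin m)) :=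
  (Finset.image
    (fun t : Fin n × Fin m × Fin m × Fin n × Fin m =>
      ({(t.1, t.2.1), (t.1, t.2.2.1), (t.2.2.2.1, t.2.2.2.2)} : Multiset (Fin n × Fin m)))
    (Finset.univ.filter fun t : Fin n × Fin m × Fin m × Fin n × Fin m =>
      t.2.1 ≠ t.2.2.1 ∧ t.1 ≠ t.2.2.2.1)).val

open Finset in
/-- A nonnegative matrix with all row and column sums `1` has a transversal in its support. -/
theorem exists_equiv_forall_ne_zero_of_sum_eq_one {I J : Type*} [Fintype I] [Fintype J]
    (M : I → J → ℚ) (h0 : ∀ i j, 0 ≤ M i j) (hrow : ∀ i, ∑ j, M i j = 1)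
    (hcol : ∀ j, ∑ i, M i j = 1) : ∃ φ : I ≃ J, ∀ i, M i (φ i) ≠ 0 := by
  classical
  obtain ⟨φ, hinj, hφ⟩ := (Finset.all_card_le_biUnion_card_iff_exists_injective
    fun i => univ.filter fun j => M i j ≠ 0).1 fun A => by
      set N := A.biUnion fun i => univ.filter fun j => M i j ≠ 0 with hN
      have h1 : ∀ i ∈ A, ∑ j ∈ N, M i j = 1 := fun i hi => by
        rw [← hrow i]
        refine sum_subset (subset_univ _) fun j _ hj => ?_
        by_contra h
        exact hj (mem_biUnion.2 ⟨i, hi, by simpa using h⟩)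
      have h2 : (#A : ℚ) ≤ #N := calc
        (#A : ℚ) = ∑ i ∈ A, ∑ j ∈ N, M i j := by rw [sum_congr rfl h1]; simp
        _ = ∑ j ∈ N, ∑ i ∈ A, M i j := sum_comm
        _ ≤ ∑ j ∈ N, ∑ i, M i j :=
          sum_le_sum fun j _ => sum_le_univ_sum_of_nonneg fun i => h0 i j
        _ = #N := by simp [hcol]
      exact_mod_cast h2
  have hcard : Fintype.card I = Fintype.card J := by
    have h : ∑ i, ∑ j, M i j = ∑ j, ∑ i, M i j := sum_comm
    simp only [hrow, hcol, sum_const, card_univ, nsmul_eq_mul, mul_one] at h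
    exact_mod_cast h
  refine ⟨Equiv.ofBijective φ ((Fintype.bijective_iff_injective_and_card φ).2 ⟨hinj, hcard⟩),
    fun i => ?_⟩
  simpa using hφ i

open Finset in
/-- Rounding: a fractional subset of `E` whose weight is integral on each fibre of `f` and of `t`
can be replaced by a genuine subset with the same fibre weights. -/
theorem exists_finset_card_fiber_eq {E C T : Type*} [Fintype E] [Fintype C] [Fintype T]
    [DecidableEq C] [DecidableEq T]
    (f : E → C) (t : E → T) (x : E → ℚ) (hx0 : ∀ e, 0 ≤ x e) (hx1 : ∀ e, x e ≤ 1)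
    (r : C → ℕ) (s : T → ℕ) (hr : ∀ c, ∑ e with f e = c, x e = r c)
    (hs : ∀ b, ∑ e with t e = b, x e = s b) :
    ∃ S : Finset E, (∀ c, #{e ∈ S | f e = c} = r c) ∧ ∀ b, #{e ∈ S | t e = b} = s b := by
  classical
  have key : ∀ (A : Finset E) (q : ℕ), ∑ e ∈ A, x e = q → ∀ e ∈ A, (q : ℚ) * (x e / q) = x e := by
    intro A q hq e he
    by_cases h : (q : ℚ) = 0
    · simp [(sum_eq_zero_iff_of_nonneg fun e _ => hx0 e).1 (hq.trans h) e he]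
    · field_simp
  have keyf : ∀ e, (r (f e) : ℚ) * (x e / r (f e)) = x e := fun e => key _ _ (hr _) e (by simp)
  have keyt : ∀ e, (s (t e) : ℚ) * (x e / s (t e)) = x e := fun e => key _ _ (hs _) e (by simp)
  let M : (Σ c, Fin (r c)) ⊕ E → E ⊕ (Σ b, Fin (s b)) → ℚ := fun i j =>
    match i, j with
    | .inl c, .inl e => if f e = c.1 then x e / r c.1 else 0
    | .inl _, .inr _ => 0
    | .inr e, .inl e' => if e = e' then 1 - x e else 0
    | .inr e, .inr b => if t e = b.1 then x e / s b.1 else 0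
  obtain ⟨φ, hφ⟩ := exists_equiv_forall_ne_zero_of_sum_eq_one M (by
      rintro (c | e) (e' | b) <;> simp only [M] <;> try split_ifs
      all_goals first
        | exact le_rfl
        | exact sub_nonneg.2 (hx1 _)
        | exact div_nonneg (hx0 _) (Nat.cast_nonneg _)) (by
      rintro (⟨c, a⟩ | e)
      · have : (r c : ℚ) ≠ 0 := by have := a.pos; positivity
        simp only [M, Fintype.sum_sum_type, sum_const_zero, add_zero]
        rw [← sum_filter, ← sum_div, hr, div_self this]
      · simp only [M, Fintype.sum_sum_type, Fintype.sum_sigma]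
        simp [keyt]) (by
      rintro (e | ⟨b, a⟩)
      · simp only [M, Fintype.sum_sum_type, Fintype.sum_sigma]
        simp [keyf]
      · have : (s b : ℚ) ≠ 0 := by have := a.pos; positivity
        simp only [M, Fintype.sum_sum_type, sum_const_zero, zero_add]
        rw [← sum_filter, ← sum_div, hs, div_self this])
  have hleft : ∀ c (a : Fin (r c)), ∃ e, φ (.inl ⟨c, a⟩) = .inl e ∧ f e = c := by
    intro c a
    have h := hφ (.inl ⟨c, a⟩)
    rcases hj : φ (.inl ⟨c, a⟩) with e | b
    · refine ⟨e, rfl, ?_⟩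
      by_contra hne
      simp [hj, M, hne] at h
    · simp [hj, M] at h
  have hright : ∀ b (a : Fin (s b)), ∃ e, φ (.inr e) = .inr ⟨b, a⟩ ∧ t e = b := by
    intro b a
    obtain ⟨i, hi⟩ := φ.surjective (.inr ⟨b, a⟩)
    have h := hφ i
    rcases i with c | e
    · simp [hi, M] at h
    · refine ⟨e, hi, ?_⟩
      by_contra hne
      simp [hi, M, hne] at h
  choose u hu hfu using hleft
  choose w hw htw using hright
  refine ⟨univ.filter fun e => φ (.inr e) ≠ .inl e, fun c => ?_, fun b => ?_⟩
  · have : (univ.filter fun e => φ (.inr e) ≠ .inl e).filter (fun e => f e = c)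
        = univ.image (u c) := by
      ext e
      simp only [mem_filter, mem_univ, true_and, mem_image]
      constructor
      · rintro ⟨he, rfl⟩
        obtain ⟨i, hi⟩ := φ.surjective (.inl e)
        rcases i with ⟨c, a⟩ | e'
        · have h1 : u c a = e := by simpa [hi] using (hu c a).symm
          subst h1
          have h2 := hfu c a
          generalize u c a = z at *
          subst h2
          exact ⟨a, by simpa [hi] using (hu _ a).symm⟩
        · have h := hφ (.inr e')
          rw [hi] at h
          by_cases hee : e' = e
          · exact absurd (hee ▸ hi) he
          · simp [M, hee] at h
      · rintro ⟨a, rfl⟩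
        refine ⟨fun h => ?_, hfu c a⟩
        simpa using φ.injective (h.trans (hu c a).symm)
    rw [this, card_image_of_injective, card_univ, Fintype.card_fin]
    intro a a' h
    simpa using φ.injective ((hu c a).trans ((congrArg _ h).trans (hu c a').symm))
  · have : (univ.filter fun e => φ (.inr e) ≠ .inl e).filter (fun e => t e = b)
        = univ.image (w b) := by
      ext e
      simp only [mem_filter, mem_univ, true_and, mem_image]
      constructor
      · rintro ⟨he, rfl⟩
        have h := hφ (.inr e)
        rcases hj : φ (.inr e) with e' | ⟨b, a⟩
        · rw [hj] at h
          by_cases hee : e = e'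
          · exact absurd (hee ▸ hj) he
          · simp [M, hee] at h
        · rw [hj] at h
          have h1 : t e = b := by
            by_contra hne
            simp [M, hne] at h
          subst h1
          exact ⟨a, by simpa using φ.injective ((hw _ a).trans hj.symm)⟩
      · rintro ⟨a, rfl⟩
        exact ⟨by simp [hw], htw b a⟩
    rw [this, card_image_of_injective, card_univ, Fintype.card_fin]
    intro a a' h
    have := (hw b a).symm.trans ((congrArg (fun z => φ (.inr z)) h).trans (hw b a'))
    simpa using this

open Finset in
/-- Two functions whose fibres have the same sizes differ by a permutation of the domain. -/
theorem exists_perm_comp_eq_of_card_fiber_eq {E K : Type*} [Fintype E] [DecidableEq K]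
    (κ κ' : E → K) (h : ∀ b, #{e | κ e = b} = #{e | κ' e = b}) :
    ∃ π : Equiv.Perm E, ∀ e, κ' (π e) = κ e := by
  refine ⟨Equiv.ofFiberEquiv (f := κ) (g := κ') fun b => Fintype.equivOfCardEq ?_,
    Equiv.ofFiberEquiv_map _⟩
  rw [Fintype.card_subtype, Fintype.card_subtype, h]

open Finset in
/-- The number of edges of colour `c` through the vertex `v`. -/
def colorDegree {E C V : Type*} [Fintype E] [DecidableEq C] [DecidableEq V]
    (ed : E → Finset V) (f : E → C) (c : C) (v : V) : ℕ :=
  #{e | f e = c ∧ v ∈ ed e}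

open Finset in
theorem sum_colorDegree {E C V : Type*} [Fintype E] [DecidableEq C] [DecidableEq V]
    (ed : E → Finset V) (f : E → C) (c : C) (A : Finset V) :
    ∑ v ∈ A, colorDegree ed f c v = ∑ e with f e = c, #(ed e ∩ A) := by
  simp only [colorDegree, card_filter]
  rw [sum_comm, sum_filter]
  refine sum_congr rfl fun e _ => ?_
  by_cases h : f e = c
  · simp [h, inter_comm]
  · simp [h]

open Finset in
/-- Baranyai's step: if the vertices of `P` have the prescribed colour degrees, and the remaining
vertices of each part have them on average, then one more vertex can be added to `P`. -/
theorem exists_coloring_insert {E C V I : Type*} [Fintype E] [Fintype C] [DecidableEq C]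
    [Fintype V] [DecidableEq V] [DecidableEq I] (ed : E → Finset V) (part : V → I)
    (hsymm : ∀ v w, part v = part w → ∃ ρ : E → E, Function.Injective ρ ∧
      ∀ e, ed (ρ e) = (ed e).map (Equiv.swap v w).toEmbedding)
    (r : C → ℕ) (P : Finset V) (v : V) (hv : v ∉ P) (f : E → C)
    (hP : ∀ c, ∀ w ∈ P, colorDegree ed f c w = r c)
    (hU : ∀ c i, ∑ w with w ∉ P ∧ part w = i, colorDegree ed f c w
      = r c * #{w | w ∉ P ∧ part w = i}) :
    ∃ f' : E → C, (∀ c, ∀ w ∈ insert v P, colorDegree ed f' c w = r c) ∧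
      ∀ c i, ∑ w with w ∉ insert v P ∧ part w = i, colorDegree ed f' c w
        = r c * #{w | w ∉ insert v P ∧ part w = i} := by
  classical
  let U : I → Finset V := fun i => {w | w ∉ P ∧ part w = i}
  let τ : E → Finset V × (I → ℕ) := fun e => (ed e ∩ P, fun i => #(ed e ∩ U i))
  let t : E → Set.range τ := fun e => ⟨τ e, e, rfl⟩
  have hτt : ∀ {e e'}, t e = t e' → τ e = τ e' := fun h => congrArg Subtype.val h
  have hvU : v ∈ U (part v) := by simp [U, hv]
  have hle : ∀ b, ∀ w ∈ U (part v), ∀ w' ∈ U (part v),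
      colorDegree ed t b w ≤ colorDegree ed t b w' := by
    intro b w hw w' hw'
    simp only [U, mem_filter, mem_univ, true_and] at hw hw'
    obtain ⟨ρ, hinj, hρ⟩ := hsymm w w' (hw.2.trans hw'.2.symm)
    refine card_le_card_of_injOn ρ (fun e he => ?_) hinj.injOn
    simp only [coe_filter, mem_univ, true_and, Set.mem_ofPred_eq] at he ⊢
    have hP' : P.map (Equiv.swap w w').toEmbedding = P := by
      ext u
      rw [mem_map_equiv, Equiv.symm_swap, Equiv.swap_apply_def]
      grind
    have hU' : ∀ i, (U i).map (Equiv.swap w w').toEmbedding = U i := by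
      intro i
      ext u
      rw [mem_map_equiv, Equiv.symm_swap, Equiv.swap_apply_def]
      simp only [U, mem_filter, mem_univ, true_and]
      grind
    refine ⟨?_, ?_⟩
    · rw [← he.1]
      refine Subtype.ext (Prod.ext ?_ (funext fun i => ?_))
      · change ed (ρ e) ∩ P = ed e ∩ P
        rw [hρ]
        ext u
        rw [mem_inter, mem_inter, mem_map_equiv, Equiv.symm_swap, Equiv.swap_apply_def]
        grind
      · change #(ed (ρ e) ∩ U i) = #(ed e ∩ U i)
        rw [hρ, ← hU' i, ← map_inter, card_map, hU' i]
    · rw [hρ, mem_map_equiv, Equiv.symm_swap, Equiv.swap_apply_right]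
      exact he.2
  have hg : (0 : ℚ) < #(U (part v)) := by exact_mod_cast card_pos.2 ⟨v, hvU⟩
  obtain ⟨S, hSf, hSt⟩ := exists_finset_card_fiber_eq f t
    (fun e => (#(ed e ∩ U (part v)) : ℚ) / #(U (part v))) (fun e => by positivity)
    (fun e => by
      rw [div_le_one hg]
      exact_mod_cast card_le_card inter_subset_right)
    r (fun b => colorDegree ed t b v)
    (fun c => by
      rw [← sum_div, div_eq_iff hg.ne', ← Nat.cast_sum, ← sum_colorDegree]
      exact_mod_cast hU c (part v))
    (fun b => by
      rw [← sum_div, div_eq_iff hg.ne', ← Nat.cast_sum, ← sum_colorDegree ed t b,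
        sum_congr rfl fun w hw => le_antisymm (hle b w hw v hvU) (hle b v hvU w hw)]
      simp [mul_comm])
  obtain ⟨π, hπ⟩ := exists_perm_comp_eq_of_card_fiber_eq (fun e => (t e, decide (v ∈ ed e)))
    (fun e => (t e, decide (e ∈ S))) (by
      have h1 : ∀ b, #{e | t e = b ∧ v ∈ ed e} = #{e | t e = b ∧ e ∈ S} := by
        intro b
        refine Eq.trans (hSt b).symm (congrArg card ?_)
        ext e
        simp [and_comm]
      rintro ⟨b, _ | _⟩
      · have h2 := card_filter_add_card_filter_not (s := univ.filter fun e => t e = b)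
          (fun e => v ∈ ed e)
        have h3 := card_filter_add_card_filter_not (s := univ.filter fun e => t e = b)
          (fun e => e ∈ S)
        simp only [filter_filter] at h2 h3
        have h4 := h1 b
        simp only [Prod.mk.injEq, decide_eq_false_iff_not]
        omega
      · simpa using h1 b)
  simp only [Prod.mk.injEq, decide_eq_decide] at hπ
  have hπP : ∀ e, ∀ w ∈ P, w ∈ ed (π e) ↔ w ∈ ed e := by
    intro e w hw
    have h : ed (π e) ∩ P = ed e ∩ P := congrArg Prod.fst (hτt (hπ e).1)
    have := congrArg (fun A => w ∈ A) h
    simpa [hw] using this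
  have hπU : ∀ e i, #(ed (π e) ∩ U i) = #(ed e ∩ U i) := fun e i =>
    congrFun (congrArg Prod.snd (hτt (hπ e).1)) i
  have hnewP : ∀ c, ∀ w ∈ P, colorDegree ed (f ∘ π) c w = r c := by
    intro c w hw
    rw [← hP c w hw]
    refine card_equiv π fun e => ?_
    simp [hπP e w hw]
  have hnewv : ∀ c, colorDegree ed (f ∘ π) c v = r c := by
    intro c
    rw [← hSf c]
    refine card_equiv π fun e => ?_
    simp [(hπ e).2, and_comm]
  have hnewU : ∀ c i, ∑ w ∈ U i, colorDegree ed (f ∘ π) c w = r c * #(U i) := by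
    intro c i
    rw [← hU c i, sum_colorDegree, sum_colorDegree]
    exact sum_equiv π (by simp) fun e _ => (hπU e i).symm
  refine ⟨f ∘ π, fun c w hw => ?_, fun c i => ?_⟩
  · rcases mem_insert.1 hw with rfl | hw
    exacts [hnewv c, hnewP c w hw]
  · have hfil : (univ.filter fun w => w ∉ insert v P ∧ part w = i) = (U i).erase v := by
      ext w
      simp only [U, mem_filter, mem_univ, true_and, mem_erase, mem_insert]
      tauto
    rw [hfil]
    by_cases hi : v ∈ U i
    · have h1 := hnewU c i
      rw [← add_sum_erase _ _ hi, hnewv, ← card_erase_add_one hi] at h1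
      linarith
    · rw [erase_eq_of_notMem hi]
      exact hnewU c i

open Finset in
/-- If the edges are invariant under transpositions within the parts and the colour degrees are
right on average on each part, then some recolouring has the right colour degree at every
vertex. -/
theorem exists_coloring_colorDegree_eq {E C V I : Type*} [Fintype E] [Fintype C] [DecidableEq C]
    [Fintype V] [DecidableEq V] [DecidableEq I] (ed : E → Finset V) (part : V → I)
    (hsymm : ∀ v w, part v = part w → ∃ ρ : E → E, Function.Injective ρ ∧
      ∀ e, ed (ρ e) = (ed e).map (Equiv.swap v w).toEmbedding)
    (r : C → ℕ) (f : E → C)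
    (hf : ∀ c i, ∑ w with part w = i, colorDegree ed f c w = r c * #{w | part w = i}) :
    ∃ f' : E → C, ∀ c w, colorDegree ed f' c w = r c := by
  have h : ∀ P : Finset V, ∃ f' : E → C, (∀ c, ∀ w ∈ P, colorDegree ed f' c w = r c) ∧
      ∀ c i, ∑ w with w ∉ P ∧ part w = i, colorDegree ed f' c w
        = r c * #{w | w ∉ P ∧ part w = i} := by
    intro P
    induction P using Finset.induction_on with
    | empty => exact ⟨f, by simp, by simpa using hf⟩
    | insert v P hv ih =>
      obtain ⟨f', h1, h2⟩ := ih
      exact exists_coloring_insert ed part hsymm r P v hv f' h1 h2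
  obtain ⟨f', h1, -⟩ := h univ
  exact ⟨f', fun c w => h1 c w (mem_univ w)⟩

open Finset in
/-- The edge `{(i, j), (i, j'), (i + d, l)}` with `p = {j, j'}`, as a function of the data
`(i, d, p, l)`. -/
def blockEdge {n m : ℕ} [NeZero n]
    (b : Fin n × {d : Fin n // d ≠ 0} × {p : Finset (Fin m) // #p = 2} × Fin m) :
    Finset (Fin n × Fin m) :=
  insert (b.1 + b.2.1, b.2.2.2) (b.2.2.1.1.map (Function.Embedding.sectR b.1 (Fin m)))

theorem mem_blockEdge {n m : ℕ} [NeZero n]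
    (b : Fin n × {d : Fin n // d ≠ 0} × {p : Finset (Fin m) // p.card = 2} × Fin m)
    (v : Fin n × Fin m) :
    v ∈ blockEdge b ↔ v = (b.1 + b.2.1, b.2.2.2) ∨ v.1 = b.1 ∧ v.2 ∈ b.2.2.1.1 := by
  obtain ⟨x, y⟩ := v
  simp only [blockEdge, Finset.mem_insert, Finset.mem_map, Function.Embedding.sectR_apply,
    Prod.mk.injEq]
  grind

open Finset in
theorem card_blockEdge_inter {n m : ℕ} [NeZero n]
    (b : Fin n × {d : Fin n // d ≠ 0} × {p : Finset (Fin m) // #p = 2} × Fin m) (j : Fin n) :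
    #(blockEdge b ∩ ({w | w.1 = j} : Finset (Fin n × Fin m)))
      = 2 * (if b.1 = j then 1 else 0) + if b.1 + b.2.1 = j then 1 else 0 := by
  obtain ⟨i, ⟨d, hd⟩, ⟨p, hp⟩, l⟩ := b
  have hne : i + d ≠ i := by simpa using hd
  by_cases h1 : i = j
  · subst h1
    have : blockEdge (i, ⟨d, hd⟩, ⟨p, hp⟩, l) ∩ ({w | w.1 = i} : Finset (Fin n × Fin m))
        = p.map (Function.Embedding.sectR i (Fin m)) := by
      ext ⟨x, y⟩
      simp [mem_blockEdge]
      grind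
    simp [this, hp, hd]
  · by_cases h2 : i + d = j
    · subst h2
      have : blockEdge (i, ⟨d, hd⟩, ⟨p, hp⟩, l) ∩ ({w | w.1 = i + d} : Finset (Fin n × Fin m))
          = {(i + d, l)} := by
        ext ⟨x, y⟩
        simp [mem_blockEdge]
        grind
      simp [this, hd]
    · have : blockEdge (i, ⟨d, hd⟩, ⟨p, hp⟩, l) ∩ ({w | w.1 = j} : Finset (Fin n × Fin m))
          = ∅ := by
        ext ⟨x, y⟩
        simp [mem_blockEdge]
        grind
      simp [this, h1, h2]

open Finset in
theorem blockEdge_injective {n m : ℕ} [NeZero n] :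
    Function.Injective (blockEdge (n := n) (m := m)) := by
  intro b b' h
  have hfst : b.1 = b'.1 := by
    have h1 := card_blockEdge_inter b b.1
    rw [h, card_blockEdge_inter b' b.1] at h1
    by_contra hne
    rw [if_neg (Ne.symm hne)] at h1
    split_ifs at h1 <;> omega
  have hsnd : b.2.1 = b'.2.1 := by
    have h1 := card_blockEdge_inter b (b.1 + b.2.1)
    rw [h, card_blockEdge_inter b' (b.1 + b.2.1), hfst] at h1
    have hd := b.2.1.2
    refine Subtype.ext ?_
    by_contra hne
    simp [hd, Ne.symm hne] at h1
  obtain ⟨i, ⟨d, hd⟩, ⟨p, hp⟩, l⟩ := b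
  obtain ⟨i', ⟨d', hd'⟩, ⟨p', hp'⟩, l'⟩ := b'
  simp only [Subtype.mk.injEq] at hfst hsnd
  subst hfst hsnd
  have hmem : ∀ v, v ∈ blockEdge (i, ⟨d, hd⟩, ⟨p, hp⟩, l)
      ↔ v ∈ blockEdge (i, ⟨d, hd⟩, ⟨p', hp'⟩, l') := fun v => by rw [h]
  simp only [mem_blockEdge] at hmem
  have hl : l = l' := by
    have := hmem (i + d, l)
    simpa [hd] using this
  have hpp : p = p' := by
    ext y
    have := hmem (i, y)
    simpa [hd] using this
  subst hl hpp
  rfl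

open Finset in
theorem K3mn_eq_map_blockEdge (n m : ℕ) [NeZero n] :
    K3mn n m = (univ : Finset (Fin n × {d : Fin n // d ≠ 0} × {p : Finset (Fin m) // #p = 2} ×
      Fin m)).val.map fun b => (blockEdge b).val := by
  have hinj : Function.Injective fun b : Fin n × {d : Fin n // d ≠ 0} ×
      {p : Finset (Fin m) // #p = 2} × Fin m => (blockEdge b).val :=
    fun b b' h => blockEdge_injective (Finset.val_injective h)
  have hval : ∀ (i : Fin n) (d : {d : Fin n // d ≠ 0}) (j j' l : Fin m) (hj : j ≠ j'),
      (blockEdge (i, d, ⟨{j, j'}, card_pair hj⟩, l)).val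
        = {(i, j), (i, j'), (i + d.1, l)} := by
    intro i d j j' l hj
    have hne : i ≠ i + d.1 := by simpa using d.2
    refine (Multiset.Nodup.ext (Finset.nodup _) (by simp [hj, hne])).2 fun v => ?_
    obtain ⟨x, y⟩ := v
    rw [Finset.mem_val, mem_blockEdge]
    simp
    grind
  refine (Multiset.Nodup.ext (Finset.nodup _) (Multiset.Nodup.map hinj (Finset.nodup _))).2
    fun e => ?_
  simp only [Finset.mem_val, mem_image, mem_filter, mem_univ, true_and, Multiset.mem_map]
  constructor
  · rintro ⟨⟨i, j, j', k, l⟩, ⟨hj, hi⟩, rfl⟩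
    refine ⟨(i, ⟨k - i, sub_ne_zero.2 (Ne.symm hi)⟩, ⟨{j, j'}, card_pair hj⟩, l), ?_⟩
    rw [hval _ _ _ _ _ hj]
    simp
  · rintro ⟨⟨i, d, ⟨p, hp⟩, l⟩, rfl⟩
    obtain ⟨j, j', hj, rfl⟩ := card_eq_two.1 hp
    exact ⟨(i, j, j', i + d.1, l), ⟨hj, by simpa using d.2⟩, (hval i d j j' l hj).symm⟩

open Finset in
theorem exists_blockEdge_swap {n m : ℕ} [NeZero n] (v w : Fin n × Fin m) (h : v.1 = w.1) :
    ∃ ρ : Fin n × {d : Fin n // d ≠ 0} × {p : Finset (Fin m) // #p = 2} × Fin m →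
        Fin n × {d : Fin n // d ≠ 0} × {p : Finset (Fin m) // #p = 2} × Fin m,
      ∀ b, blockEdge (ρ b) = (blockEdge b).map (Equiv.swap v w).toEmbedding := by
  obtain ⟨a, y⟩ := v
  obtain ⟨a', z⟩ := w
  obtain rfl : a = a' := h
  let σ : Fin n → Equiv.Perm (Fin m) := fun i => if i = a then Equiv.swap y z else 1
  have hσ : ∀ u : Fin n × Fin m, Equiv.swap (a, y) (a, z) u = (u.1, σ u.1 u.2) := by
    rintro ⟨i, u⟩
    simp only [σ, Equiv.swap_apply_def]
    split_ifs <;> simp_all [Equiv.swap_apply_def]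
  have hσσ : ∀ i u, σ i (σ i u) = u := by
    intro i u
    by_cases hi : i = a <;> simp [σ, hi]
  refine ⟨fun b => (b.1, b.2.1, ⟨b.2.2.1.1.map (σ b.1).toEmbedding, by simp [b.2.2.1.2]⟩,
    σ (b.1 + b.2.1) b.2.2.2), fun b => ?_⟩
  obtain ⟨i, d, p, l⟩ := b
  ext ⟨i', u⟩
  rw [mem_map_equiv, Equiv.symm_swap, hσ, mem_blockEdge, mem_blockEdge]
  have hsymm : ∀ i u, (σ i).symm u = σ i u := fun i u => by rw [Equiv.symm_apply_eq, hσσ]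
  simp only [mem_map_equiv, hsymm, Prod.mk.injEq]
  have hl : ∀ i, σ i u = l ↔ u = σ i l := fun i => by rw [← Equiv.eq_symm_apply, hsymm]
  clear_value σ
  grind

theorem Finset.val_map_eq_sum_singleton {E α : Type*} (s : Finset E) (g : E → α) :
    s.val.map g = ∑ e ∈ s, {g e} := by
  rw [← Multiset.sum_map_singleton (s.val.map g), Multiset.map_map]
  rfl

open Finset in
theorem exists_factorization_smul_K3mn (m n lambda k : ℕ) (hn : 0 < n) (r : Fin k → ℕ)
    (hS1 : ∀ i, 3 ∣ r i * m) (hS3 : ∑ i, r i = 3 * lambda * (n - 1) * m.choose 2) :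
    ∃ F : Fin k → Multiset (Multiset (Fin n × Fin m)),
      (∑ i, F i) = lambda • K3mn n m ∧ ∀ i, ∀ v, hdeg (F i) v = r i := by
  have : NeZero n := ⟨hn.ne'⟩
  let B := {d : Fin n // d ≠ 0} × {p : Finset (Fin m) // #p = 2} × Fin m
  let ed : Fin lambda × Fin n × B → Finset (Fin n × Fin m) := fun e => blockEdge e.2
  choose s hs using hS1
  have hcard : Fintype.card (Fin lambda × B) = Fintype.card (Σ c, Fin (s c)) := by
    have h1 : 3 * ∑ c, s c = 3 * (lambda * (n - 1) * m.choose 2 * m) := by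
      rw [mul_sum, ← sum_congr rfl fun c _ => hs c, ← sum_mul, hS3]
      ring
    have h2 : Fintype.card {d : Fin n // d ≠ 0} = n - 1 := by
      simp [Fintype.card_subtype_compl]
    have h3 : Fintype.card {p : Finset (Fin m) // #p = 2} = m.choose 2 := by
      simp
    simp only [B, Fintype.card_prod, Fintype.card_sigma, Fintype.card_fin, h2, h3]
    linarith
  let g : Fin lambda × B → Fin k := fun x => (Fintype.equivOfCardEq hcard x).1
  have hg : ∀ c, #{x | g x = c} = s c := by
    intro c
    rw [← Fintype.card_fin (s c), ← card_univ,
      ← card_map (Function.Embedding.sigmaMk (β := fun c => Fin (s c)) c)]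
    refine card_equiv (Fintype.equivOfCardEq hcard) fun x => ?_
    simp only [g, mem_filter, mem_univ, true_and, mem_map, Function.Embedding.sigmaMk_apply]
    constructor
    · rintro rfl
      exact ⟨_, rfl⟩
    · rintro ⟨a, ha⟩
      rw [← ha]
  obtain ⟨f, hf⟩ := exists_coloring_colorDegree_eq ed Prod.fst (fun v w hvw => by
      obtain ⟨ρ, hρ⟩ := exists_blockEdge_swap v w hvw
      refine ⟨fun e => (e.1, ρ e.2), fun e e' h => ?_, fun e => hρ e.2⟩
      simp only [Prod.mk.injEq] at h
      refine Prod.ext h.1 (blockEdge_injective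
        (map_injective (Equiv.swap v w).toEmbedding ?_))
      rw [← hρ, ← hρ, h.2]) r (fun e => g (e.1, e.2.2)) (fun c j => by
      have hpart : #{w : Fin n × Fin m | w.1 = j} = m := by
        have : ({w : Fin n × Fin m | w.1 = j} : Finset _)
            = univ.map (Function.Embedding.sectR j (Fin m)) := by
          ext ⟨x, y⟩
          simp [eq_comm]
        simp [this]
      have hrow : ∀ d : Fin n,
          ∑ i, (2 * (if i = j then 1 else 0) + if i + d = j then 1 else 0) = 3 := by
        intro d
        simp [sum_add_distrib, ← eq_sub_iff_add_eq]
      rw [sum_colorDegree, hpart, hs, ← hg, sum_filter, Fintype.sum_prod_type]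
      simp only [Fintype.sum_prod_type (α₁ := Fin n), ed, card_blockEdge_inter]
      rw [card_filter, mul_sum, Fintype.sum_prod_type]
      refine sum_congr rfl fun a _ => ?_
      rw [sum_comm]
      refine sum_congr rfl fun x _ => ?_
      by_cases h : g (a, x) = c
      · simpa [h] using hrow x.1
      · simp [h])
  refine ⟨fun c => (univ.filter fun e => f e = c).val.map fun e => (ed e).val, ?_,
    fun c v => ?_⟩
  · simp only [Finset.val_map_eq_sum_singleton]
    rw [sum_fiberwise, Fintype.sum_prod_type, K3mn_eq_map_blockEdge,
      Finset.val_map_eq_sum_singleton]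
    simp only [ed, sum_const, card_univ, Fintype.card_fin]
    rfl
  · rw [← hf c v, colorDegree, hdeg, ← filter_filter, card_filter, Multiset.map_map]
    exact sum_congr rfl fun e _ => Multiset.count_eq_of_nodup (ed e).nodup

/-- **Theorem (factorization of `λ𝒦³_{m×n}`).**
If `3 ∣ rᵢ m`, `2 ∣ rᵢ m n` for all `i`, and `∑ rᵢ = 3 λ (n-1) C(m,2)`, then the
edge multiset of `λ𝒦³_{m×n}` can be partitioned into `F₁, …, F_k` where `Fᵢ` is a
spanning `rᵢ`-regular sub-hypergraph. -/
theorem lambda_K3mn_factorization (m n lambda k : ℕ) (hm : 0 < m) (hn : 0 < n)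
    (hlambda : 0 < lambda) (hk : 0 < k) (r : Fin k → ℕ) (hr : ∀ i, 0 < r i)
    (hS1 : ∀ i, 3 ∣ r i * m)
    (hS2 : ∀ i, 2 ∣ r i * m * n)
    (hS3 : ∑ i, r i = 3 * lambda * (n - 1) * m.choose 2) :
    ∃ F : Fin k → Multiset (Multiset (Fin n × Fin m)),
      (∑ i, F i) = lambda • K3mn n m ∧ ∀ i, ∀ v, hdeg (F i) v = r i := by
  exact exists_factorization_smul_K3mn m n lambda k hn r hS1 hS3
end

section
/- Let m, n, λ, k be positive integers and r_1, …, r_k be positive integers such that 3 divides r_i·m and 2 divides r_i·m·n for each i ∈ [k], and r_1 + ⋯ + r_k = 3·λ·(n−1)·C(m,2). Then for every ℓ with n ≤ ℓ ≤ m·n there exists a k-edge-colored n-partite 3-uniform hypergraph 𝒢 = (V,E) on ℓ vertices and a function g : V → ℕ (positive integers) satisfying: (C1) Σ_{v∈W} g(v) = m for each part W of 𝒢; (C2) the multiplicity of the edge {u,u,v} equals λ·C(g(u),2)·g(v) for each pair of vertices u, v lying in different parts; (C3) the multiplicity of the edge {u,v,w} equals λ·g(u)·g(v)·g(w) for each pair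 of distinct vertices u, w in the same part and each vertex v in a different part; (C4) the degree of u in the sub-hypergraph of color i equals r_i·g(u) for each color i ∈ [k] and each vertex u ∈ V; and every edge not of the forms described in (C2) and (C3) has multiplicity 0. -/
open Finset in
theorem exists_balanced_subset_of_fintype {E T I : Type*} [Fintype E] [DecidableEq E]
    [Fintype T] [DecidableEq T] [Fintype I] [DecidableEq I]
    (τ : E → T) (κ : E → I) (a : ℕ) (ha : 0 < a) (h : E → ℕ) (hle : ∀ e, h e ≤ a)
    (hτ : ∀ t, a ∣ ∑ e with τ e = t, h e) (hκ : ∀ i, a ∣ ∑ e with κ e = i, h e) :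
    ∃ J : Finset E, (∀ t, a * #{e ∈ J | τ e = t} = ∑ e with τ e = t, h e) ∧
      ∀ i, a * #{e ∈ J | κ e = i} = ∑ e with κ e = i, h e := by
  choose c hc using hτ
  have hκ' : ∀ i, a ∣ ∑ e with κ e = i, (a - h e) := by
    intro i
    have : ∑ e with κ e = i, (a - h e) + ∑ e with κ e = i, h e = ∑ e with κ e = i, a := by
      rw [← sum_add_distrib]
      exact sum_congr rfl fun e _ => Nat.sub_add_cancel (hle e)
    rw [← Nat.dvd_add_left (hκ i), this]
    exact dvd_sum fun _ _ => dvd_rfl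
  choose d hd using hκ'
  have hsum : ∀ A : Finset E, ∑ e ∈ A, h e + ∑ e ∈ A, (a - h e) = a * #A := by
    intro A
    rw [← sum_add_distrib, sum_congr rfl fun e _ => Nat.add_sub_cancel' (hle e), sum_const,
      smul_eq_mul, mul_comm]
  let N : E → Finset ((Σ t : T, Fin (c t)) ⊕ (Σ i : I, Fin (d i))) := fun e =>
    (({τ e} : Finset T).sigma fun _ => univ).disjSum (({κ e} : Finset I).sigma fun _ => univ)
  have hall : ∀ A : Finset E, #A ≤ #(A.biUnion N) := by
    intro A
    have hsub : ((A.image τ).sigma fun t => (univ : Finset (Fin (c t)))).disjSum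
        ((A.image κ).sigma fun i => (univ : Finset (Fin (d i)))) ⊆ A.biUnion N := by
      rintro (⟨t, x⟩ | ⟨i, x⟩) hx <;> simp [N] at hx ⊢ <;> obtain ⟨e, he, rfl⟩ := hx <;>
        exact ⟨e, he, rfl⟩
    have hcard := card_le_card hsub
    simp only [card_disjSum, card_sigma, card_univ, Fintype.card_fin] at hcard
    refine Nat.le_of_mul_le_mul_left ?_ ha
    refine le_trans ?_ (Nat.mul_le_mul_left a hcard)
    rw [← hsum, mul_add, mul_sum, mul_sum]
    refine add_le_add ?_ ?_
    · rw [← sum_fiberwise_of_maps_to (g := τ) (t := A.image τ)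
        fun e he => mem_image_of_mem _ he]
      refine sum_le_sum fun t _ => ?_
      rw [← hc]
      exact sum_le_sum_of_subset (filter_subset_filter _ (subset_univ _))
    · rw [← sum_fiberwise_of_maps_to (g := κ) (t := A.image κ)
        fun e he => mem_image_of_mem _ he]
      refine sum_le_sum fun i _ => ?_
      rw [← hd]
      exact sum_le_sum_of_subset (filter_subset_filter _ (subset_univ _))
  obtain ⟨f, hf, hfN⟩ := (all_card_le_biUnion_card_iff_exists_injective N).1 hall
  have hinl : ∀ e x, f e = Sum.inl x → x.1 = τ e := by
    intro e x hx
    have := hfN e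
    rw [hx] at this
    simpa [N] using this
  have hinr : ∀ e x, f e = Sum.inr x → x.1 = κ e := by
    intro e x hx
    have := hfN e
    rw [hx] at this
    simpa [N] using this
  have hbij : Function.Bijective f := by
    rw [Fintype.bijective_iff_injective_and_card]
    refine ⟨hf, Nat.eq_of_mul_eq_mul_left ha ?_⟩
    rw [← card_univ, ← hsum]
    simp only [Fintype.card_sum, Fintype.card_sigma, Fintype.card_fin, mul_add, mul_sum, ← hc,
      ← hd]
    rw [sum_fiberwise, sum_fiberwise]
  refine ⟨univ.filter fun e => (f e).isLeft, fun t => ?_, fun i => ?_⟩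
  · rw [hc]
    congr 1
    have : (({e ∈ univ.filter fun e => (f e).isLeft | τ e = t}).image f)
        = (univ : Finset (Fin (c t))).image fun x => Sum.inl ⟨t, x⟩ := by
      ext y
      simp only [mem_image, mem_filter, mem_univ, true_and]
      constructor
      · rintro ⟨e, ⟨he, rfl⟩, rfl⟩
        obtain ⟨⟨t, x⟩, hx⟩ := Sum.isLeft_iff.1 he
        obtain rfl : t = τ e := hinl e _ hx
        exact ⟨x, hx.symm⟩
      · rintro ⟨x, rfl⟩
        obtain ⟨e, he⟩ := hbij.2 (Sum.inl ⟨t, x⟩)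
        exact ⟨e, ⟨by simp [he], (hinl e _ he).symm⟩, he⟩
    rw [← card_image_of_injective _ hf, this, card_image_of_injective, card_univ,
      Fintype.card_fin]
    intro x y hxy
    simpa using hxy
  · have hR : #{e ∈ univ.filter fun e => ¬ (f e).isLeft | κ e = i} = d i := by
      have : (({e ∈ univ.filter fun e => ¬ (f e).isLeft | κ e = i}).image f)
          = (univ : Finset (Fin (d i))).image fun x => Sum.inr ⟨i, x⟩ := by
        ext y
        simp only [mem_image, mem_filter, mem_univ, true_and]
        constructor
        · rintro ⟨e, ⟨he, rfl⟩, rfl⟩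
          rw [Sum.not_isLeft] at he
          obtain ⟨⟨t, x⟩, hx⟩ := Sum.isRight_iff.1 he
          obtain rfl : t = κ e := hinr e _ hx
          exact ⟨x, hx.symm⟩
        · rintro ⟨x, rfl⟩
          obtain ⟨e, he⟩ := hbij.2 (Sum.inr ⟨i, x⟩)
          exact ⟨e, ⟨by simp [he], (hinr e _ he).symm⟩, he⟩
      rw [← card_image_of_injective _ hf, this, card_image_of_injective, card_univ,
        Fintype.card_fin]
      intro x y hxy
      simpa using hxy
    have hsplit := card_filter_add_card_filter_not (s := univ.filter fun e => κ e = i)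
      (fun e => ((f e).isLeft : Prop))
    have htot := hsum (univ.filter fun e => κ e = i)
    rw [hd, ← hsplit, mul_add, filter_comm, filter_comm (fun e => κ e = i) (fun e => ¬ _),
      hR] at htot
    omega

open Finset in
/-- Balanced selection: a weighting `h ≤ a` whose sum over every fibre of `τ` and of `κ` is a
multiple of `a` can be rounded to a set `J` meeting each fibre in exactly `1 / a` of its weight. -/
theorem exists_balanced_subset {E T I : Type*} [Fintype E] [DecidableEq E]
    [DecidableEq T] [Fintype I] [DecidableEq I]
    (τ : E → T) (κ : E → I) (a : ℕ) (ha : 0 < a) (h : E → ℕ) (hle : ∀ e, h e ≤ a)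
    (hτ : ∀ t, a ∣ ∑ e with τ e = t, h e) (hκ : ∀ i, a ∣ ∑ e with κ e = i, h e) :
    ∃ J : Finset E, (∀ t, a * #{e ∈ J | τ e = t} = ∑ e with τ e = t, h e) ∧
      ∀ i, a * #{e ∈ J | κ e = i} = ∑ e with κ e = i, h e := by
  let τ' : E → univ.image τ := fun e => ⟨τ e, mem_image_of_mem _ (mem_univ e)⟩
  obtain ⟨J, hJ, hJ'⟩ := exists_balanced_subset_of_fintype τ' κ a ha h hle
    (fun t => by simpa [τ', Subtype.ext_iff] using hτ t.1) hκ
  refine ⟨J, fun t => ?_, hJ'⟩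
  by_cases ht : t ∈ univ.image τ
  · simpa [τ', Subtype.ext_iff] using hJ ⟨t, ht⟩
  · have hne : ∀ e, τ e ≠ t := fun e he => ht (he ▸ mem_image_of_mem _ (mem_univ e))
    simp [hne]
open Finset in
/-- The colored hypergraph with edges `edge e` of color `col e` is an amalgamation, with `g v`
vertices merged into `v`, of `lam` copies of the hypergraph of all sets whose multiset of parts
satisfies `Q`, colored so that color class `i` is regular of degree `r i`. -/
structure IsAmalgamation {V E I P : Type*} [Fintype V] [DecidableEq V] [Fintype E]
    [DecidableEq I] (part : V → P) (Q : Multiset P → Prop) (lam : ℕ) (r : I → ℕ)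
    (col : E → I) (g : V → ℕ) (edge : E → Multiset V) : Prop where
  form : ∀ e, Q ((edge e).map part)
  mult : ∀ M : Multiset V, Q (M.map part) →
    #{e | edge e = M} = lam * ∏ v, (g v).choose (M.count v)
  degree : ∀ i u, ∑ e with col e = i, (edge e).count u = r i * g u

namespace IsAmalgamation

variable {V E I P : Type*} [Fintype V] [DecidableEq V] [Fintype E] [DecidableEq I]
  {part : V → P} {Q : Multiset P → Prop} {lam : ℕ} {r : I → ℕ} {col : E → I} {g : V → ℕ}
  {edge : E → Multiset V}

theorem count_le (H : IsAmalgamation part Q lam r col g edge) (e : E) (v : V) :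
    (edge e).count v ≤ g v := by
  by_contra! hlt
  have h0 := H.mult _ (H.form e)
  rw [Finset.prod_eq_zero (Finset.mem_univ v) (Nat.choose_eq_zero_of_lt hlt), mul_zero,
    Finset.card_eq_zero] at h0
  exact Finset.notMem_empty e (h0 ▸ by simp)

open Finset in
/-- Splitting off one vertex `β` from an amalgamated vertex `α` of the same part. -/
theorem exists_split [Fintype I] (H : IsAmalgamation part Q lam r col g edge) {α β : V}
    (hpart : part α = part β) {a : ℕ} (hα : g α = a + 1) (hβ : g β = 0) :
    ∃ edge' : E → Multiset V, IsAmalgamation part Q lam r col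
      (Function.update (Function.update g α a) β 1) edge' := by
  classical
  have hne : α ≠ β := by rintro rfl; omega
  have hnotin : ∀ e, β ∉ edge e := by
    intro e he
    have := H.count_le e β
    rw [hβ] at this
    exact absurd (Multiset.count_pos.2 he) (by omega)
  have hmulα : ∀ M : Multiset V, ∑ e with edge e = M, (edge e).count α
      = #{e | edge e = M} * M.count α := by
    intro M
    rw [sum_congr rfl fun e he => by rw [(mem_filter.1 he).2], sum_const, smul_eq_mul]
  -- the product over the vertices other than `α`
  let R : Multiset V → ℕ := fun M => ∏ v ∈ univ.erase α, (g v).choose (M.count v)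
  have hR : ∀ M, ∏ v, (g v).choose (M.count v) = (a + 1).choose (M.count α) * R M := by
    intro M
    rw [← mul_prod_erase univ _ (mem_univ α), hα]
  have hkey : ∀ M : Multiset V, Q (M.map part) → ∀ x, M.count α = x + 1 →
      #{e | edge e = M} * M.count α = (a + 1) * (lam * (a.choose x * R M)) := by
    intro M hM x hx
    rw [H.mult M hM, hR, hx]
    have := Nat.add_one_mul_choose_eq a x
    calc lam * ((a + 1).choose (x + 1) * R M) * (x + 1)
        = lam * R M * ((a + 1).choose (x + 1) * (x + 1)) := by ring
      _ = _ := by rw [← this]; ring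
  obtain ⟨J, hJ, hJcol⟩ := exists_balanced_subset edge col (a + 1) (Nat.succ_pos a)
    (fun e => (edge e).count α) (fun e => hα ▸ H.count_le e α)
    (by
      intro M
      rw [hmulα]
      by_cases hM : Q (M.map part)
      · rcases hx : M.count α with _ | x
        · simp
        · rw [← hx, hkey M hM x hx]
          exact dvd_mul_right _ _
      · rw [filter_eq_empty_iff.2 fun e _ (he : edge e = M) => hM (he ▸ H.form e)]
        simp)
    (by
      intro i
      rw [H.degree, hα]
      exact dvd_mul_left _ _)
  have hJdeg : ∀ i, #{e ∈ J | col e = i} = r i := by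
    intro i
    have := hJcol i
    rw [H.degree, hα, mul_comm] at this
    exact Nat.eq_of_mul_eq_mul_right (Nat.succ_pos a) this
  have hJ0 : ∀ M : Multiset V, M.count α = 0 → #{e ∈ J | edge e = M} = 0 := by
    intro M hM
    have := hJ M
    rw [hmulα, hM, mul_zero] at this
    simpa using this
  have hJ1 : ∀ M : Multiset V, Q (M.map part) → ∀ x, M.count α = x + 1 →
      #{e ∈ J | edge e = M} = lam * (a.choose x * R M) := by
    intro M hM x hx
    have := hJ M
    rw [hmulα, hkey M hM x hx] at this
    exact Nat.eq_of_mul_eq_mul_left (Nat.succ_pos a) this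
  have hmem : ∀ e ∈ J, α ∈ edge e := by
    intro e he
    rw [← Multiset.count_pos, Nat.pos_iff_ne_zero]
    intro h0
    have := hJ0 _ h0
    rw [card_eq_zero] at this
    exact notMem_empty e (this ▸ by simp [he])
  let edge' : E → Multiset V := fun e => if e ∈ J then β ::ₘ (edge e).erase α else edge e
  have hin : ∀ e ∈ J, edge' e = β ::ₘ (edge e).erase α := fun e he => if_pos he
  have hout : ∀ e ∉ J, edge' e = edge e := fun e he => if_neg he
  have hg' : ∀ M : Multiset V, ∏ v, (Function.update (Function.update g α a) β 1 v).choose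
      (M.count v) = a.choose (M.count α) * ((Nat.choose 1 (M.count β)) *
        ∏ v ∈ (univ.erase α).erase β, (g v).choose (M.count v)) := by
    intro M
    rw [← mul_prod_erase univ _ (mem_univ α),
      ← mul_prod_erase (univ.erase α) _ (mem_erase.2 ⟨hne.symm, mem_univ β⟩)]
    rw [Function.update_self, Function.update_of_ne hne, Function.update_self]
    congr 2
    refine prod_congr rfl fun v hv => ?_
    simp only [mem_erase] at hv
    rw [Function.update_of_ne hv.1, Function.update_of_ne hv.2.1]
  have hRβ : ∀ M : Multiset V, β ∉ M →
      R M = ∏ v ∈ (univ.erase α).erase β, (g v).choose (M.count v) := by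
    intro M hM
    simp only [R]
    rw [← mul_prod_erase (univ.erase α) _ (mem_erase.2 ⟨hne.symm, mem_univ β⟩),
      Multiset.count_eq_zero.2 hM, Nat.choose_zero_right, one_mul]
  refine ⟨edge', ⟨fun e => ?_, fun M hM => ?_, fun i u => ?_⟩⟩
  · by_cases he : e ∈ J
    · have := H.form e
      rw [← Multiset.cons_erase (hmem e he)] at this
      rw [hin e he]
      simpa [hpart] using this
    · rw [hout e he]
      exact H.form e
  · rw [hg']
    by_cases hβM : β ∈ M
    · obtain ⟨M, rfl⟩ := Multiset.exists_cons_of_mem hβM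
      have hset : univ.filter (fun e => edge' e = β ::ₘ M) = {e ∈ J | edge e = α ::ₘ M} := by
        ext e
        simp only [mem_filter, mem_univ, true_and]
        by_cases he : e ∈ J
        · simp only [hin e he, he, true_and, Multiset.cons_inj_right]
          constructor
          · rintro rfl
            exact (Multiset.cons_erase (hmem e he)).symm
          · intro h
            rw [h, Multiset.erase_cons_head]
        · simp only [hout e he, he, false_and, iff_false]
          intro h
          exact hnotin e (h ▸ Multiset.mem_cons_self _ _)
      rw [hset]
      by_cases hβM' : β ∈ M
      · have h2 : 1 < (β ::ₘ M).count β := by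
          rw [Multiset.count_cons_self]
          have := Multiset.count_pos.2 hβM'
          omega
        rw [Nat.choose_eq_zero_of_lt h2, zero_mul, mul_zero, mul_zero, card_eq_zero,
          filter_eq_empty_iff]
        intro e _ he
        exact hnotin e (he ▸ Multiset.mem_cons_of_mem hβM')
      · rw [hJ1 (α ::ₘ M) (by simpa [hpart] using hM) (M.count α) (by simp),
          hRβ _ (by simp [hne.symm, hβM']), Multiset.count_cons_of_ne hne,
          Multiset.count_cons_self, Multiset.count_eq_zero.2 hβM', zero_add, Nat.choose_self,
          one_mul]
        congr 2
        refine prod_congr rfl fun v hv => ?_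
        simp only [mem_erase] at hv
        rw [Multiset.count_cons_of_ne hv.1, Multiset.count_cons_of_ne hv.2.1]
    · have hset : univ.filter (fun e => edge' e = M)
          = {e ∈ univ.filter (fun e => edge e = M) | e ∉ J} := by
        ext e
        simp only [mem_filter, mem_univ, true_and]
        by_cases he : e ∈ J
        · simp only [hin e he, he, not_true, and_false, iff_false]
          rintro rfl
          exact hβM (Multiset.mem_cons_self _ _)
        · simp [hout e he, he]
      have hsplit := card_filter_add_card_filter_not (s := univ.filter fun e => edge e = M)
        (fun e => e ∈ J)
      have hset' : {e ∈ univ.filter (fun e => edge e = M) | e ∈ J} = {e ∈ J | edge e = M} := by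
        ext e
        simp [and_comm]
      rw [hset', ← hset, H.mult M hM, hR] at hsplit
      rw [Multiset.count_eq_zero.2 hβM, Nat.choose_zero_right, one_mul, ← hRβ M hβM]
      rcases hx : M.count α with _ | x
      · rw [hJ0 M hx, hx] at hsplit
        simpa using hsplit
      · rw [hJ1 M hM x hx, hx, Nat.choose_succ_succ', add_mul, mul_add] at hsplit
        exact Nat.add_left_cancel hsplit
  · have hcount : ∀ e, (edge' e).count u + (if e ∈ J then if u = α then 1 else 0 else 0)
        = (edge e).count u + (if e ∈ J then if u = β then 1 else 0 else 0) := by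
      intro e
      by_cases he : e ∈ J
      · have h := congrArg (Multiset.count u) (Multiset.cons_erase (hmem e he))
        rw [Multiset.count_cons] at h
        rw [hin e he, Multiset.count_cons, ← h]
        simp only [he, if_true]
        omega
      · simp [hout e he, he]
    have hs := sum_congr (rfl : univ.filter (fun e => col e = i) = _) fun e _ => hcount e
    rw [sum_add_distrib, sum_add_distrib, H.degree] at hs
    have hJs : ∀ w, ∑ e with col e = i, (if e ∈ J then if u = w then 1 else 0 else 0)
        = if u = w then r i else 0 := by
      intro w
      rw [← sum_filter, sum_const, smul_eq_mul, mul_ite, mul_one, mul_zero, ← hJdeg i]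
      congr 2
      ext e
      simp [and_comm]
    rw [hJs, hJs] at hs
    by_cases huβ : u = β
    · subst huβ
      rw [if_neg hne.symm, if_pos rfl, hβ] at hs
      simpa using hs
    · by_cases huα : u = α
      · subst huα
        rw [if_pos rfl, if_neg hne, hα, mul_add, mul_one, add_zero] at hs
        rw [Function.update_of_ne hne, Function.update_self]
        omega
      · rw [if_neg huα, if_neg huβ] at hs
        simpa [huα, huβ] using hs

end IsAmalgamation

theorem prod_choose_count_pair {V : Type*} [Fintype V] [DecidableEq V] (g : V → ℕ) {u v : V}
    (huv : u ≠ v) :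
    ∏ x, (g x).choose (({u, u, v} : Multiset V).count x) = (g u).choose 2 * g v := by
  have hzero : ∀ x, x ∉ ({u, v} : Finset V) →
      (g x).choose (({u, u, v} : Multiset V).count x) = 1 := by
    intro x hx
    simp only [Finset.mem_insert, Finset.mem_singleton, not_or] at hx
    rw [Multiset.count_eq_zero.2 (by simp [hx.1, hx.2]), Nat.choose_zero_right]
  rw [← Finset.prod_subset (Finset.subset_univ {u, v}) fun x _ hx => hzero x hx,
    Finset.prod_pair huv]
  simp [huv, huv.symm]

theorem prod_choose_count_triple {V : Type*} [Fintype V] [DecidableEq V] (g : V → ℕ) {u v w : V}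
    (huv : u ≠ v) (huw : u ≠ w) (hvw : v ≠ w) :
    ∏ x, (g x).choose (({u, v, w} : Multiset V).count x) = g u * g v * g w := by
  have hzero : ∀ x, x ∉ ({u, v, w} : Finset V) →
      (g x).choose (({u, v, w} : Multiset V).count x) = 1 := by
    intro x hx
    simp only [Finset.mem_insert, Finset.mem_singleton, not_or] at hx
    rw [Multiset.count_eq_zero.2 (by simp [hx.1, hx.2.1, hx.2.2]), Nat.choose_zero_right]
  rw [← Finset.prod_subset (Finset.subset_univ {u, v, w}) fun x _ hx => hzero x hx,
    Finset.prod_insert (by simp [huv, huw]), Finset.prod_pair hvw]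
  simp [huv, huv.symm, huw, huw.symm, hvw, hvw.symm, mul_assoc]

/-- The part patterns `{a, a, b}`, `a ≠ b`, of the edges of a multipartite 3-uniform
hypergraph. -/
def IsTwoOnePattern {P : Type*} (N : Multiset P) : Prop :=
  ∃ a b : P, a ≠ b ∧ N = {a, a, b}

open Finset in
/-- The amalgamation of `K3mn` in which every part is a single vertex, colored by means of
cyclic shifts of the parts. -/
theorem exists_isAmalgamation_collapsed (m n lam k : ℕ) [NeZero m] [NeZero n] (r : Fin k → ℕ)
    (h3 : ∀ i, 3 ∣ r i * m) (hsum : ∑ i, r i = 3 * lam * (n - 1) * m.choose 2) :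
    ∃ (edge : (Σ i, Fin (r i * m / 3)) × Fin n → Multiset (Fin n × Fin m)),
      IsAmalgamation Prod.fst IsTwoOnePattern lam r (fun e => e.1.1)
        (fun v : Fin n × Fin m => if v.2 = 0 then m else 0) edge := by
  classical
  have hcard : Fintype.card (Σ i, Fin (r i * m / 3))
      = Fintype.card (Fin (lam * (m.choose 2 * m)) × {d : Fin n // d ≠ 0}) := by
    simp only [Fintype.card_sigma, Fintype.card_fin, Fintype.card_prod,
      Fintype.card_subtype_compl, Fintype.card_subtype_eq]
    refine Nat.eq_of_mul_eq_mul_left (by norm_num : 0 < 3) ?_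
    rw [mul_sum, sum_congr rfl fun i _ => Nat.mul_div_cancel' (h3 i), ← sum_mul, hsum]
    ring
  let φ := Fintype.equivOfCardEq hcard
  let edge : (Σ i, Fin (r i * m / 3)) × Fin n → Multiset (Fin n × Fin m) := fun e =>
    {(e.2, 0), (e.2, 0), (e.2 + (φ e.1).2.1, 0)}
  have hd : ∀ (a : Fin n) x, a ≠ a + (φ x).2.1 := by
    intro a x h
    exact (φ x).2.2 (by simpa using h)
  refine ⟨edge, ⟨fun e => ⟨e.2, e.2 + (φ e.1).2.1, hd _ _, by simp [edge]⟩, fun M hM => ?_,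
    fun i u => ?_⟩⟩
  · by_cases h0 : ∀ v ∈ M, v.2 = 0
    · obtain ⟨a, b, hab, hMab⟩ := hM
      obtain rfl : M = {(a, 0), (a, 0), (b, 0)} := by
        calc M = M.map fun v => (v.1, (0 : Fin m)) := by
              conv_lhs => rw [← Multiset.map_id M]
              exact Multiset.map_congr rfl fun v hv => Prod.ext rfl (h0 v hv)
          _ = (M.map Prod.fst).map fun a => (a, (0 : Fin m)) := by
              rw [Multiset.map_map]; rfl
          _ = _ := by rw [hMab]; simp
      rw [prod_choose_count_pair _ (by simpa using hab)]
      simp only [if_true]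
      have hiff : ∀ e, edge e = {(a, 0), (a, 0), (b, 0)} ↔ e.2 = a ∧ (φ e.1).2.1 = b - a := by
        rintro ⟨x, c⟩
        constructor
        · intro h
          have hca : c = a := by
            by_contra hca
            have := congrArg (Multiset.count (c, (0 : Fin m))) h
            by_cases hcb : c = b
            · simp [edge, hcb, hab.symm, hd] at this
            · simp [edge, hca, hcb, hd] at this
          subst hca
          refine ⟨rfl, ?_⟩
          have : c + (φ x).2.1 = b := by simpa [edge] using h
          rw [← this]
          simp
        · rintro ⟨rfl, h⟩
          simp only at h
          simp [edge, h]
      have hcardM : #{e | edge e = {(a, 0), (a, 0), (b, 0)}}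
          = #((univ : Finset (Fin (lam * (m.choose 2 * m))))) := by
        symm
        refine card_bij (fun x _ => (φ.symm (x, ⟨b - a, sub_ne_zero.2 hab.symm⟩), a)) ?_ ?_ ?_
        · intro x _
          exact mem_filter.2 ⟨mem_univ _, (hiff _).2 ⟨rfl, by simp⟩⟩
        · intro x _ y _ hxy
          simpa using hxy
        · rintro ⟨x, c⟩ hx
          simp only [mem_filter, mem_univ, true_and, hiff] at hx
          obtain ⟨rfl, hx⟩ := hx
          refine ⟨(φ x).1, mem_univ _, ?_⟩
          simp only [Prod.mk.injEq, and_true, Equiv.symm_apply_eq]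
          exact Prod.ext rfl (Subtype.ext hx.symm)
      rw [hcardM, card_univ, Fintype.card_fin]
    · push Not at h0
      obtain ⟨v, hv, hv0⟩ := h0
      rw [prod_eq_zero (mem_univ v), mul_zero, card_eq_zero, filter_eq_empty_iff]
      · intro e _ he
        rw [← he] at hv
        simp only [edge, Multiset.insert_eq_cons, Multiset.mem_cons,
          Multiset.mem_singleton] at hv
        rcases hv with rfl | rfl | rfl <;> exact hv0 rfl
      · rw [if_neg hv0]
        exact Nat.choose_eq_zero_of_lt (Multiset.count_pos.2 hv)
  · obtain ⟨b, j⟩ := u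
    by_cases hj : j = 0
    · subst hj
      have hx : ∀ x, ∑ c, (edge (x, c)).count (b, 0) = 3 := by
        intro x
        have : ∀ c, (edge (x, c)).count (b, 0) = (if b = c then 1 else 0)
            + ((if b = c then 1 else 0) + if b - (φ x).2.1 = c then 1 else 0) := by
          intro c
          simp only [edge, Multiset.insert_eq_cons, Multiset.count_cons,
            Multiset.count_singleton, Prod.mk.injEq, and_true, sub_eq_iff_eq_add]
          ring
        simp [this, sum_add_distrib]
      have hfil : univ.filter (fun e : (Σ i, Fin (r i * m / 3)) × Fin n => e.1.1 = i)
          = (univ.filter fun x : Σ i, Fin (r i * m / 3) => x.1 = i) ×ˢ univ := by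
        ext e
        simp
      have hfil' : univ.filter (fun x : Σ i, Fin (r i * m / 3) => x.1 = i)
          = ({i} : Finset (Fin k)).sigma fun _ => univ := by
        ext e
        simp
      rw [hfil, sum_product, sum_congr rfl fun x _ => hx x, sum_const, hfil', card_sigma]
      simp [Nat.div_mul_cancel (h3 i)]
    · simp only [hj, if_false, mul_zero]
      refine sum_eq_zero fun e _ => Multiset.count_eq_zero.2 ?_
      simp [edge, hj]

open Finset in
theorem exists_isAmalgamation_of_card_support (m n lam k : ℕ) [NeZero m] [NeZero n]
    (r : Fin k → ℕ) (h3 : ∀ i, 3 ∣ r i * m)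
    (hsum : ∑ i, r i = 3 * lam * (n - 1) * m.choose 2) (l : ℕ) (hnl : n ≤ l) :
    l ≤ m * n → ∃ (g : Fin n × Fin m → ℕ)
      (edge : (Σ i, Fin (r i * m / 3)) × Fin n → Multiset (Fin n × Fin m)),
      #{v | g v ≠ 0} = l ∧ (∀ W, ∑ j, g (W, j) = m) ∧
      IsAmalgamation Prod.fst IsTwoOnePattern lam r (fun e => e.1.1) g edge := by
  classical
  induction l, hnl using Nat.le_induction with
  | base =>
    intro _
    obtain ⟨edge, H⟩ := exists_isAmalgamation_collapsed m n lam k r h3 hsum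
    refine ⟨_, edge, ?_, fun W => by simp, H⟩
    have : univ.filter (fun v : Fin n × Fin m => (if v.2 = 0 then m else 0) ≠ 0)
        = univ ×ˢ {0} := by
      ext v
      simp only [mem_filter, mem_univ, true_and, mem_product, mem_singleton]
      simp [NeZero.ne m]
    rw [this, card_product]
    simp
  | succ l _ ih =>
    intro hl
    obtain ⟨g, edge, hcard, hrow, H⟩ := ih (by omega)
    obtain ⟨⟨W, j⟩, hβ⟩ : ∃ v, g v = 0 := by
      by_contra! hne
      rw [filter_true_of_mem fun v _ => hne v, card_univ, Fintype.card_prod, Fintype.card_fin,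
        Fintype.card_fin, mul_comm] at hcard
      omega
    obtain ⟨j', hj'⟩ : ∃ j', 1 < g (W, j') := by
      by_contra! hle
      have : ∑ j, g (W, j) < ∑ _j : Fin m, 1 :=
        sum_lt_sum (fun i _ => hle i) ⟨j, mem_univ j, by omega⟩
      rw [hrow] at this
      simp at this
    have hjj : j ≠ j' := by rintro rfl; omega
    obtain ⟨a, ha⟩ : ∃ a, g (W, j') = a + 1 := ⟨g (W, j') - 1, by omega⟩
    obtain ⟨edge', H'⟩ := H.exists_split (α := (W, j')) (β := (W, j)) rfl ha hβ
    refine ⟨_, edge', ?_, ?_, H'⟩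
    · have : univ.filter (fun v => Function.update (Function.update g (W, j') a) (W, j) 1 v ≠ 0)
          = insert (W, j) (univ.filter fun v => g v ≠ 0) := by
        ext v
        by_cases hv : v = (W, j)
        · simp [hv]
        · by_cases hv' : v = (W, j')
          · subst hv'
            simp only [mem_filter, mem_univ, true_and, mem_insert, hv, false_or,
              Function.update_of_ne hv, Function.update_self]
            omega
          · simp [hv, hv']
      rw [this, card_insert_of_notMem (by simp [hβ]), hcard]
    · intro W'
      by_cases hW : W' = W
      · subst hW
        have hg := hrow W'
        rw [← add_sum_erase univ _ (mem_univ j), ← add_sum_erase (univ.erase j) _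
          (mem_erase.2 ⟨hjj.symm, mem_univ j'⟩)] at hg ⊢
        have hrest : ∀ x ∈ (univ.erase j).erase j',
            Function.update (Function.update g (W', j') a) (W', j) 1 (W', x) = g (W', x) := by
          intro x hx
          simp only [mem_erase] at hx
          rw [Function.update_of_ne (by simp [hx.2.1]), Function.update_of_ne (by simp [hx.1])]
        rw [sum_congr rfl hrest, Function.update_self,
          Function.update_of_ne (by simpa using hjj.symm), Function.update_self]
        rw [ha, hβ] at hg
        omega
      · refine Eq.trans (sum_congr rfl fun x _ => ?_) (hrow W')
        rw [Function.update_of_ne (by simp [hW]), Function.update_of_ne (by simp [hW])]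

/-- **Theorem (general amalgamation form).**
Under the hypotheses `3 ∣ rᵢ m`, `2 ∣ rᵢ m n` (for all `i`) and
`∑ rᵢ = 3 λ (n-1) C(m,2)`, for every `ℓ` with `n ≤ ℓ ≤ m n` there is a
`k`-edge-colored `n`-partite 3-uniform hypergraph on `ℓ` vertices (given here by
the color classes `F i`, with part function `part` and total edge multiset
`∑ i, F i`) and a positive function `g` such that:
(C1) the `g`-values on each part sum to `m`;
(C2) `mult {u,u,v} = λ C(g u, 2) g v` for `u, v` in different parts;
(C3) `mult {u,v,w} = λ (g u)(g v)(g w)` for `u ≠ w` in the same part and `v` in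
a different part;
(C4) the degree of `u` in color class `i` is `rᵢ g u`;
and every edge not of the forms in (C2), (C3) has multiplicity `0`. -/
theorem lambda_K3mn_detachment (m n lambda k : ℕ) (hm : 0 < m) (hn : 0 < n)
    (hlambda : 0 < lambda) (hk : 0 < k) (r : Fin k → ℕ) (hr : ∀ i, 0 < r i)
    (hS1 : ∀ i, 3 ∣ r i * m)
    (hS2 : ∀ i, 2 ∣ r i * m * n)
    (hS3 : ∑ i, r i = 3 * lambda * (n - 1) * m.choose 2) :
    ∀ ℓ : ℕ, n ≤ ℓ → ℓ ≤ m * n →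
      ∃ (part : Fin ℓ → Fin n) (g : Fin ℓ → ℕ)
        (F : Fin k → Multiset (Multiset (Fin ℓ))),
        (∀ v, 0 < g v) ∧
        -- (C1)
        (∀ W : Fin n, ∑ v ∈ Finset.univ.filter (fun v => part v = W), g v = m) ∧
        -- (C2)
        (∀ u v : Fin ℓ, part u ≠ part v →
          (∑ i, F i).count ({u, u, v} : Multiset (Fin ℓ))
            = lambda * (g u).choose 2 * g v) ∧
        -- (C3)
        (∀ u v w : Fin ℓ, u ≠ w → part u = part w → part v ≠ part u →
          (∑ i, F i).count ({u, v, w} : Multiset (Fin ℓ))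
            = lambda * g u * g v * g w) ∧
        -- every other type of edge has multiplicity 0
        (∀ e ∈ (∑ i, F i),
          (∃ u v : Fin ℓ, part u ≠ part v ∧ e = ({u, u, v} : Multiset (Fin ℓ))) ∨
          (∃ u v w : Fin ℓ, u ≠ w ∧ part u = part w ∧ part v ≠ part u ∧
            e = ({u, v, w} : Multiset (Fin ℓ)))) ∧
        -- (C4)
        (∀ i, ∀ u, hdeg (F i) u = r i * g u) := by
  intro ℓ hnl hl
  have : NeZero m := ⟨hm.ne'⟩
  have : NeZero n := ⟨hn.ne'⟩
  classical
  obtain ⟨g, edge, hcard, hrow, H⟩ :=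
    exists_isAmalgamation_of_card_support m n lambda k r hS1 hS3 ℓ hnl hl
  let ε : {v // g v ≠ 0} ≃ Fin ℓ :=
    Fintype.equivFinOfCardEq (by rw [Fintype.card_subtype, hcard])
  let ψ : Fin ℓ → Fin n × Fin m := fun x => (ε.symm x).1
  have hψ : Function.Injective ψ := Subtype.val_injective.comp ε.symm.injective
  have hψg : ∀ x, g (ψ x) ≠ 0 := fun x => (ε.symm x).2
  have hψs : ∀ v, g v ≠ 0 → ∃ x, ψ x = v := fun v hv => ⟨ε ⟨v, hv⟩, by simp [ψ]⟩
  have hlift : ∀ e, ∃ N : Multiset (Fin ℓ), N.map ψ = edge e := by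
    intro e
    have hsupp : ∀ v ∈ edge e, g v ≠ 0 := by
      intro v hv h0
      have := H.count_le e v
      rw [h0] at this
      exact absurd (Multiset.count_pos.2 hv) (by omega)
    refine ⟨(edge e).pmap (fun v hv => ε ⟨v, hv⟩) hsupp, ?_⟩
    rw [Multiset.map_pmap]
    simp [ψ, Multiset.pmap_eq_map]
  choose edge' hedge' using hlift
  let F : Fin k → Multiset (Multiset (Fin ℓ)) := fun i =>
    (Finset.univ.filter fun e : (Σ i, Fin (r i * m / 3)) × Fin n => e.1.1 = i).val.map edge'
  have hcount : ∀ N : Multiset (Fin ℓ),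
      (∑ i, F i).count N = (Finset.univ.filter fun e => edge e = N.map ψ).card := by
    intro N
    have hF : ∀ i, (F i).count N
        = ((Finset.univ.filter fun e => edge e = N.map ψ).filter fun e => e.1.1 = i).card := by
      intro i
      rw [Multiset.count_map, ← Finset.filter_val, Finset.card_val, Finset.filter_comm]
      congr 2
      ext e
      simp only [Finset.mem_filter, Finset.mem_univ, true_and, ← hedge']
      rw [(Multiset.map_injective hψ).eq_iff, eq_comm]
    rw [Multiset.count_sum', Finset.sum_congr rfl fun i _ => hF i]
    exact (Finset.card_eq_sum_card_fiberwise fun _ _ => Finset.mem_coe.2 (Finset.mem_univ _)).symm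
  refine ⟨fun x => (ψ x).1, fun x => g (ψ x), F, fun v => Nat.pos_of_ne_zero (hψg v),
    fun W => ?_, fun u v huv => ?_, fun u v w huw hpuw hpvu => ?_, fun N hN => ?_,
    fun i u => ?_⟩
  · refine Eq.trans ?_ (hrow W)
    have h1 : ∑ j, g (W, j) = ∑ v with v.1 = W, g v := by
      refine Finset.sum_bij (fun j _ => (W, j)) ?_ ?_ ?_ ?_
      · simp
      · simp
      · rintro ⟨W', j⟩ h
        simp only [Finset.mem_filter, Finset.mem_univ, true_and] at h
        exact ⟨j, Finset.mem_univ j, by rw [h]⟩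
      · simp
    rw [h1, ← Finset.sum_filter_ne_zero
      (s := Finset.univ.filter fun v : Fin n × Fin m => v.1 = W)]
    refine Finset.sum_bij (fun x _ => ψ x) ?_ ?_ ?_ ?_
    · intro x hx
      simpa [hψg] using hx
    · intro x _ y _ hxy
      exact hψ hxy
    · intro v hv
      simp only [Finset.mem_filter, Finset.mem_univ, true_and] at hv
      obtain ⟨x, rfl⟩ := hψs v hv.2
      exact ⟨x, by simpa using hv.1, rfl⟩
    · simp
  · have hne : ψ u ≠ ψ v := fun h => huv (congrArg Prod.fst h)
    rw [hcount, H.mult _ ⟨(ψ u).1, (ψ v).1, huv, by simp⟩]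
    simp only [Multiset.insert_eq_cons, Multiset.map_cons, Multiset.map_singleton]
    have := prod_choose_count_pair g hne
    simp only [Multiset.insert_eq_cons] at this
    rw [this, mul_assoc]
  · have huv : ψ u ≠ ψ v := fun h => hpvu (congrArg Prod.fst h).symm
    have hvw : ψ v ≠ ψ w := fun h => hpvu ((congrArg Prod.fst h).trans hpuw.symm)
    rw [hcount, H.mult _ ⟨(ψ u).1, (ψ v).1, Ne.symm hpvu, ?_⟩]
    · simp only [Multiset.insert_eq_cons, Multiset.map_cons, Multiset.map_singleton]
      have := prod_choose_count_triple g huv (hψ.ne huw) hvw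
      simp only [Multiset.insert_eq_cons] at this
      rw [this]
      ring
    · simp only [Multiset.insert_eq_cons, Multiset.map_cons, Multiset.map_singleton, ← hpuw]
      congr 1
      exact Multiset.pair_comm _ _
  · obtain ⟨e, he⟩ : ∃ e, edge e = N.map ψ := by
      have := Multiset.count_pos.2 hN
      rw [hcount, Finset.card_pos] at this
      obtain ⟨e, he⟩ := this
      exact ⟨e, (Finset.mem_filter.1 he).2⟩
    obtain ⟨a, b, hab, hN'⟩ := H.form e
    rw [he, Multiset.map_map] at hN'
    obtain ⟨u, hu, hua, hN'⟩ := (Multiset.map_eq_cons _ _ _ _).2 hN'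
    obtain ⟨w, hw, hwa, hN'⟩ := (Multiset.map_eq_cons _ _ _ _).2 hN'
    obtain ⟨v, hv, hvb⟩ := Multiset.map_eq_singleton.1 hN'
    have hNeq : N = {u, w, v} := by
      rw [← Multiset.cons_erase hu, ← Multiset.cons_erase hw, hv]
      rfl
    simp only [Function.comp_apply] at hua hwa hvb
    by_cases huw : u = w
    · subst huw
      exact Or.inl ⟨u, v, fun h => hab (hua.symm.trans (h.trans hvb)), hNeq⟩
    · refine Or.inr ⟨u, v, w, huw, hua.trans hwa.symm,
        fun h => hab (hua.symm.trans (h.symm.trans hvb)), ?_⟩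
      rw [hNeq]
      exact congrArg (u ::ₘ ·) (Multiset.pair_comm w v)
  · rw [← H.degree i (ψ u), hdeg, Multiset.map_map, Finset.sum]
    congr 1
    refine Multiset.map_congr rfl fun e _ => ?_
    rw [← hedge', Multiset.count_map_eq_count' ψ _ hψ]
    rfl
end

section
/- Let n, λ, k be positive integers and r_1, …, r_k be positive integers. The λ-fold complete graph λK_n admits an (r_1,…,r_k)-factorization (a partition of its edge multiset into F_1,…,F_k where each F_i is a spanning r_i-regular subgraph) if and only if r_i·n is even for each i ∈ [k] and r_1 + ⋯ + r_k = λ·(n−1). -/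
/-- The `λ`-fold complete graph `λKₙ` on `Fin n`, viewed as a multiset of
edges: every pair of distinct vertices is joined by exactly `λ` parallel
edges. -/
def lamKn (lambda n : ℕ) : Multiset (Multiset (Fin n)) :=
  lambda • (Finset.image (fun p : Fin n × Fin n => ({p.1, p.2} : Multiset (Fin n)))
    (Finset.univ.filter fun p : Fin n × Fin n => p.1 ≠ p.2)).val

/-- The edges of the complete graph on `Fin n`. -/
def completeEdges (n : ℕ) : Finset (Multiset (Fin n)) :=
  Finset.image (fun p : Fin n × Fin n => ({p.1, p.2} : Multiset (Fin n)))
    (Finset.univ.filter fun p : Fin n × Fin n => p.1 ≠ p.2)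

theorem lamKn_eq_nsmul (lambda n : ℕ) : lamKn lambda n = lambda • (completeEdges n).val := rfl

theorem mem_completeEdges {n : ℕ} {e : Multiset (Fin n)} :
    e ∈ completeEdges n ↔ ∃ x y, x ≠ y ∧ ({x, y} : Multiset (Fin n)) = e := by
  simp [completeEdges]

section Hdeg

variable {V : Type*} [DecidableEq V]

theorem hdeg_zero (v : V) : hdeg 0 v = 0 := by simp [hdeg]

theorem hdeg_add (E F : Multiset (Multiset V)) (v : V) :
    hdeg (E + F) v = hdeg E v + hdeg F v := by simp [hdeg]

theorem hdeg_sum {ι : Type*} (s : Finset ι) (F : ι → Multiset (Multiset V)) (v : V) :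
    hdeg (∑ i ∈ s, F i) v = ∑ i ∈ s, hdeg (F i) v := by
  classical
  induction s using Finset.induction_on with
  | empty => simp [hdeg_zero]
  | insert a s ha ih => rw [Finset.sum_insert ha, Finset.sum_insert ha, hdeg_add, ih]

theorem hdeg_nsmul (c : ℕ) (E : Multiset (Multiset V)) (v : V) :
    hdeg (c • E) v = c * hdeg E v := by
  induction c with
  | zero => simp [hdeg_zero]
  | succ c ih => rw [succ_nsmul, hdeg_add, ih, Nat.succ_mul]

/-- The handshake lemma. -/
theorem sum_hdeg_eq_two_mul_card [Fintype V] (E : Multiset (Multiset V))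
    (hE : ∀ e ∈ E, e.card = 2) : ∑ v, hdeg E v = 2 * E.card := by
  induction E using Multiset.induction_on with
  | empty => simp [hdeg_zero]
  | cons e E ih =>
    have h1 : ∑ v, e.count v = 2 := by
      rw [Multiset.sum_count_eq_card fun _ _ => Finset.mem_univ _, hE e (by simp)]
    have h2 := ih fun e he => hE e (Multiset.mem_cons_of_mem he)
    simp only [hdeg, Multiset.map_cons, Multiset.sum_cons, Finset.sum_add_distrib,
      Multiset.card_cons] at h2 ⊢
    omega

end Hdeg

theorem pair_eq_pair_iff {V : Type*} {a b c d : V} :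
    ({a, b} : Multiset V) = {c, d} ↔ a = c ∧ b = d ∨ a = d ∧ b = c := by
  constructor
  · intro h
    have h' : a ::ₘ ({b} : Multiset V) = c ::ₘ {d} := h
    rw [Multiset.cons_eq_cons] at h'
    rcases h' with ⟨h1, h2⟩ | ⟨_, cs, h1, h2⟩
    · exact Or.inl ⟨h1, by simpa using h2⟩
    · have hb : c ∈ ({b} : Multiset V) := h1 ▸ Multiset.mem_cons_self c cs
      have hd : a ∈ ({d} : Multiset V) := h2 ▸ Multiset.mem_cons_self a cs
      exact Or.inr ⟨Multiset.mem_singleton.1 hd, (Multiset.mem_singleton.1 hb).symm⟩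
  · rintro (⟨rfl, rfl⟩ | ⟨rfl, rfl⟩)
    · rfl
    · exact Multiset.pair_comm _ _

theorem hdeg_filter_completeEdges {n : ℕ} (P : Multiset (Fin n) → Prop) [DecidablePred P]
    (v : Fin n) :
    hdeg ((completeEdges n).val.filter P) v
      = (Finset.univ.filter fun w => w ≠ v ∧ P {v, w}).card := by
  have h1 : hdeg ((completeEdges n).val.filter P) v
      = ∑ e ∈ (completeEdges n).filter P, e.count v := rfl
  have h2 : ∀ e ∈ (completeEdges n).filter P, e.count v = if v ∈ e then 1 else 0 := by
    intro e he
    obtain ⟨x, y, hxy, rfl⟩ := mem_completeEdges.1 (Finset.mem_filter.1 he).1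
    split_ifs with hv
    · exact Multiset.count_eq_one_of_mem (by simpa using hxy) hv
    · exact Multiset.count_eq_zero.2 hv
  rw [h1, Finset.sum_congr rfl h2, ← Finset.card_filter]
  symm
  refine Finset.card_bij (fun w _ => ({v, w} : Multiset (Fin n))) ?_ ?_ ?_
  · intro w hw
    simp only [Finset.mem_filter, Finset.mem_univ, true_and] at hw ⊢
    exact ⟨⟨mem_completeEdges.2 ⟨v, w, hw.1.symm, rfl⟩, hw.2⟩, by simp⟩
  · intro w _ w' _ h
    rcases pair_eq_pair_iff.1 h with h | h
    · exact h.2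
    · exact h.2.trans h.1
  · intro e he
    simp only [Finset.mem_filter, Finset.mem_univ, true_and] at he ⊢
    obtain ⟨⟨he, hP⟩, hv⟩ := he
    obtain ⟨x, y, hxy, rfl⟩ := mem_completeEdges.1 he
    have hv' : v = x ∨ v = y := by simpa using hv
    rcases hv' with rfl | rfl
    · exact ⟨y, ⟨hxy.symm, hP⟩, rfl⟩
    · exact ⟨x, ⟨hxy, by rwa [Multiset.pair_comm]⟩, Multiset.pair_comm _ _⟩

theorem hdeg_lamKn (lambda n : ℕ) (v : Fin n) : hdeg (lamKn lambda n) v = lambda * (n - 1) := by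
  have h := hdeg_filter_completeEdges (fun _ => True) v
  rw [Multiset.filter_true] at h
  rw [lamKn_eq_nsmul, hdeg_nsmul, h]
  simp [Finset.filter_ne']

/-- Equally regular colour classes of an edge colouring of `Kₙ` can be distributed over the factors
of `λKₙ`. -/
theorem exists_factorization_of_coloring {α : Type*} [DecidableEq α] {n lambda k s : ℕ}
    (c : Fin n → Fin n → α) (S : Finset α) (hsymm : ∀ x y, c x y = c y x)
    (hmem : ∀ x y, x ≠ y → c x y ∈ S)
    (hreg : ∀ v, ∀ t ∈ S, (Finset.univ.filter fun w => w ≠ v ∧ c v w = t).card = s)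
    (q : Fin k → ℕ) (hq : ∑ i, q i = lambda * S.card) :
    ∃ F : Fin k → Multiset (Multiset (Fin n)),
      (∑ i, F i) = lamKn lambda n ∧ ∀ i, ∀ v, hdeg (F i) v = q i * s := by
  by_cases hα : Nonempty α
  swap
  · have hS : S = ∅ := Finset.eq_empty_of_forall_notMem fun x _ => hα ⟨x⟩
    have hq0 : ∀ i, q i = 0 := by simpa [hS] using hq
    have hE : completeEdges n = ∅ := Finset.eq_empty_of_forall_notMem fun e he => by
      obtain ⟨x, y, _, _⟩ := mem_completeEdges.1 he
      exact hα ⟨c x y⟩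
    exact ⟨fun _ => 0, by simp [lamKn_eq_nsmul, hE], fun i v => by simp [hq0, hdeg_zero]⟩
  obtain ⟨C, hC⟩ : ∃ C : Multiset (Fin n) → α, ∀ x y, C {x, y} = c x y := by
    obtain ⟨a⟩ := hα
    have hf : Function.FactorsThrough (fun p : Fin n × Fin n => c p.1 p.2)
        (fun p : Fin n × Fin n => ({p.1, p.2} : Multiset (Fin n))) := by
      rintro ⟨x, y⟩ ⟨z, w⟩ h
      rcases pair_eq_pair_iff.1 h with ⟨h1, h2⟩ | ⟨h1, h2⟩
      · simp_all
      · simp only at h1 h2 ⊢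
        rw [h1, h2, hsymm]
    exact ⟨_, fun x y => hf.extend_apply (fun _ => a) (x, y)⟩
  let M : α → Multiset (Multiset (Fin n)) := fun t => (completeEdges n).val.filter fun e => C e = t
  have hM : ∑ t ∈ S, M t = (completeEdges n).val := by
    ext e
    rw [Multiset.count_sum']
    simp only [M, Multiset.count_filter, Finset.sum_ite_eq]
    split_ifs with h
    · rfl
    · symm
      rw [Multiset.count_eq_zero]
      intro he
      obtain ⟨x, y, hxy, rfl⟩ := mem_completeEdges.1 he
      exact h (hC x y ▸ hmem x y hxy)
  have hdegM : ∀ t ∈ S, ∀ v, hdeg (M t) v = s := by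
    intro t ht v
    rw [← hreg v t ht]
    simp only [M, hdeg_filter_completeEdges, hC]
  have hcard : Fintype.card (Σ i, Fin (q i)) = Fintype.card (Fin lambda × S) := by simp [hq]
  let f : (Σ i, Fin (q i)) ≃ Fin lambda × S := Fintype.equivOfCardEq hcard
  refine ⟨fun i => ∑ j : Fin (q i), M (f ⟨i, j⟩).2, ?_, ?_⟩
  · rw [← Fintype.sum_sigma' (fun i (j : Fin (q i)) => M (f ⟨i, j⟩).2),
      f.sum_comp (fun p => M p.2), Fintype.sum_prod_type]
    simp only
    rw [Finset.sum_coe_sort S M, hM]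
    simp [lamKn_eq_nsmul]
  · intro i v
    rw [hdeg_sum, Finset.sum_congr rfl fun j _ => hdegM _ (f ⟨i, j⟩).2.2 v]
    simp

/-- The colouring of the edges of `Kₘ₊₁` on the vertices `0, …, m` by the classical round-robin
construction with centre `m`; for odd `m` it is a `1`-factorization. -/
def roundRobin (m x y : ℕ) : ℕ :=
  let z := if x = m then 2 * y else if y = m then 2 * x else x + y
  if z < m then z else z - m

theorem card_roundRobin_eq (a : ℕ) (v : Fin (2 * a + 2)) (t : ℕ) (ht : t < 2 * a + 1) :
    (Finset.univ.filter fun w : Fin (2 * a + 2) =>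
      w ≠ v ∧ roundRobin (2 * a + 1) v w = t).card = 1 := by
  obtain ⟨v, hv⟩ := v
  rw [Finset.card_eq_one]
  have key : ∃ u < 2 * a + 2, ∀ w < 2 * a + 2,
      (w ≠ v ∧ roundRobin (2 * a + 1) v w = t) ↔ w = u := by
    simp only [roundRobin]
    by_cases h : v = 2 * a + 1
    · refine ⟨if t % 2 = 0 then t / 2 else (t + (2 * a + 1)) / 2, ?_, ?_⟩ <;> grind
    · by_cases h2 : 2 * v = t ∨ 2 * v = t + (2 * a + 1)
      · refine ⟨2 * a + 1, ?_, ?_⟩ <;> grind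
      · refine ⟨if v ≤ t then t - v else t + (2 * a + 1) - v, ?_, ?_⟩ <;> grind
  obtain ⟨u, hu, h⟩ := key
  refine ⟨⟨u, hu⟩, ?_⟩
  ext ⟨w, hw⟩
  simpa using h w hw

/-- The cyclic distance of `x` and `y` modulo `n`. -/
def cyclicDist (n x y : ℕ) : ℕ := min (max x y - min x y) (n - (max x y - min x y))

theorem card_cyclicDist_eq (a : ℕ) (v : Fin (2 * a + 1)) (t : ℕ) (ht : t ∈ Finset.Icc 1 a) :
    (Finset.univ.filter fun w : Fin (2 * a + 1) =>
      w ≠ v ∧ cyclicDist (2 * a + 1) v w = t).card = 2 := by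
  obtain ⟨v, hv⟩ := v
  rw [Finset.mem_Icc] at ht
  rw [Finset.card_eq_two]
  refine ⟨⟨if v + t < 2 * a + 1 then v + t else v + t - (2 * a + 1), by split_ifs <;> omega⟩,
    ⟨if t ≤ v then v - t else v + (2 * a + 1) - t, by split_ifs <;> omega⟩, ?_, ?_⟩
  · simp only [ne_eq, Fin.mk.injEq]
    split_ifs <;> omega
  · ext ⟨w, hw⟩
    rw [Finset.mem_filter]
    simp only [cyclicDist, ne_eq, Finset.mem_univ, true_and, Fin.mk.injEq,
      Finset.mem_insert, Finset.mem_singleton]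
    split_ifs <;> omega

/-- **Theorem (Bahmanian–Rodger).** `λKₙ` is `(r₁, …, r_k)`-factorable if and
only if `rᵢ n` is even for each `i` and `∑ rᵢ = λ (n - 1)`. -/
theorem lamKn_factorization_iff (n lambda k : ℕ) (hn : 0 < n) (hlambda : 0 < lambda)
    (hk : 0 < k) (r : Fin k → ℕ) (hr : ∀ i, 0 < r i) :
    (∃ F : Fin k → Multiset (Multiset (Fin n)),
        (∑ i, F i) = lamKn lambda n ∧ ∀ i, ∀ v, hdeg (F i) v = r i)
      ↔ ((∀ i, Even (r i * n)) ∧ ∑ i, r i = lambda * (n - 1)) := by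
  constructor
  · rintro ⟨F, hF, hdeg_eq⟩
    refine ⟨fun i => ?_, ?_⟩
    · have hcard : ∀ e ∈ F i, e.card = 2 := by
        intro e he
        have hmem : e ∈ lamKn lambda n := by
          rw [← hF]
          exact Multiset.mem_sum.2 ⟨i, Finset.mem_univ i, he⟩
        rw [lamKn_eq_nsmul] at hmem
        obtain ⟨x, y, _, rfl⟩ := mem_completeEdges.1 (Multiset.mem_of_mem_nsmul hmem)
        simp
      have h := sum_hdeg_eq_two_mul_card (F i) hcard
      simp only [hdeg_eq, Finset.sum_const, Finset.card_univ, Fintype.card_fin, smul_eq_mul] at h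
      rw [mul_comm, h]
      exact even_two_mul _
    · rw [← hdeg_lamKn lambda n ⟨0, hn⟩, ← hF, hdeg_sum]
      exact Finset.sum_congr rfl fun i _ => (hdeg_eq i _).symm
  · rintro ⟨heven, hsum⟩
    rcases Nat.even_or_odd n with hpar | hpar
    · obtain ⟨a, rfl⟩ : ∃ a, n = 2 * a + 2 := ⟨n / 2 - 1, by grind⟩
      obtain ⟨F, hF, h⟩ := exists_factorization_of_coloring (n := 2 * a + 2) (lambda := lambda)
        (s := 1) (fun x y => roundRobin (2 * a + 1) x y) (Finset.range (2 * a + 1))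
        (fun x y => by simp only [roundRobin]; grind)
        (fun x y hxy => by
          have := Fin.val_ne_of_ne hxy
          simp only [roundRobin, Finset.mem_range]
          grind)
        (fun v t ht => card_roundRobin_eq a v t (Finset.mem_range.1 ht)) r (by simpa using hsum)
      exact ⟨F, hF, by simpa using h⟩
    · obtain ⟨a, rfl⟩ := hpar
      have hr2 : ∀ i, r i / 2 * 2 = r i := fun i =>
        Nat.div_mul_cancel (even_iff_two_dvd.1
          ((Nat.even_mul.1 (heven i)).resolve_right (by simp)))
      have hq : ∑ i, r i / 2 = lambda * (Finset.Icc 1 a).card := by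
        have h : (∑ i, r i / 2) * 2 = lambda * a * 2 := by
          rw [Finset.sum_mul, Finset.sum_congr rfl fun i _ => hr2 i, hsum, Nat.add_sub_cancel]
          ring
        simpa using h
      obtain ⟨F, hF, h⟩ := exists_factorization_of_coloring (n := 2 * a + 1) (lambda := lambda)
        (s := 2) (fun x y => cyclicDist (2 * a + 1) x y) (Finset.Icc 1 a)
        (fun x y => by simp only [cyclicDist]; omega)
        (fun x y hxy => by
          have := Fin.val_ne_of_ne hxy
          simp only [cyclicDist, Finset.mem_Icc]
          omega)
        (card_cyclicDist_eq a) (fun i => r i / 2) hq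
      exact ⟨F, hF, fun i v => (h i v).trans (hr2 i)⟩
end

section
/- If 𝒜 and ℬ are two laminar families of subsets of a finite set S, and n is a positive integer, then there exists a subset A of S such that for every P ∈ 𝒜 ∪ ℬ, the cardinality |A ∩ P| satisfies ⌊|P|/n⌋ ≤ |A ∩ P| ≤ ⌈|P|/n⌉. -/
/-- Two fixed-point-free involutions have a common proper two-colouring. -/
theorem exists_coloring_of_fixedPointFree {β : Type*} (f g : Equiv.Perm β)
    (hf : ∀ x, f (f x) = x) (hg : ∀ x, g (g x) = x)
    (hf' : ∀ x, f x ≠ x) (hg' : ∀ x, g x ≠ x) :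
    ∃ c : β → Prop, (∀ x, c (f x) ↔ ¬ c x) ∧ (∀ x, c (g x) ↔ ¬ c x) := by
  have hff : f * f = 1 := Equiv.ext hf
  have hgg : g * g = 1 := Equiv.ext hg
  have hconj : f * (f * g) * f⁻¹ = (f * g)⁻¹ := by
    rw [mul_inv_rev, ← mul_assoc, hff, one_mul, inv_eq_of_mul_eq_one_left hgg]
  have hpow (k : ℤ) (x : β) : f (((f * g) ^ k) x) = ((f * g) ^ (-k)) (f x) := by
    have h : f * (f * g) ^ k * f⁻¹ = (f * g) ^ (-k) := by
      rw [← conj_zpow, hconj, inv_zpow, zpow_neg]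
    rw [← h]
    simp
  have hne (x : β) : ¬ (f * g).SameCycle x (f x) := by
    rintro ⟨k, hk⟩
    obtain ⟨m, rfl | rfl⟩ := Int.even_or_odd' k
    · apply hf' (((f * g) ^ m) x)
      rw [hpow, ← hk, ← Equiv.Perm.mul_apply, ← zpow_add]
      congr 2
      ring
    · apply hg' (((f * g) ^ m) x)
      apply f.injective
      rw [hpow, ← hk, ← Equiv.Perm.mul_apply, ← Equiv.Perm.mul_apply, ← Equiv.Perm.mul_apply,
        ← zpow_add, ← zpow_one_add]
      congr 2
      ring
  let s := Equiv.Perm.SameCycle.setoid (f * g)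
  let q : β → Quotient s := Quotient.mk s
  have hq (x : β) : q x ≠ q (f x) := fun h => hne x (Quotient.exact h)
  have hqg (x : β) : q (g x) = q (f x) := Quotient.sound ⟨1, by simp [hg]⟩
  have hqfg (x : β) : q (f (g x)) = q x := (Quotient.sound ⟨1, by simp⟩ : q x = _).symm
  have key (a b : Quotient s) (h : a ≠ b) :
      WellOrderingRel b a ↔ ¬ WellOrderingRel a b :=
    ⟨fun h1 h2 => asymm h1 h2, fun h1 =>
      ((trichotomous_of WellOrderingRel a b).resolve_left h1).resolve_left h⟩
  refine ⟨fun x => WellOrderingRel (q x) (q (f x)), fun x => ?_, fun x => ?_⟩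
  · simp only [hf]
    exact key _ _ (hq x)
  · simp only [hqg, hqfg]
    exact key _ _ (hq x)

/-- Two involutions have a two-colouring that separates the points of every orbit of size two. -/
theorem exists_coloring_of_involutive {α : Type*} {f g : α → α}
    (hf : Function.Involutive f) (hg : Function.Involutive g) :
    ∃ c : α → Prop, (∀ x, f x ≠ x → (c (f x) ↔ ¬ c x)) ∧
      (∀ x, g x ≠ x → (c (g x) ↔ ¬ c x)) := by
  classical
  let F (h : α → α) (p : α × Bool) : α × Bool := if h p.1 = p.1 then (p.1, !p.2) else (h p.1, p.2)
  have hF {h : α → α} (hh : Function.Involutive h) : Function.Involutive (F h) := by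
    rintro ⟨x, b⟩
    by_cases hx : h x = x
    · simp [F, hx]
    · simp [F, hx, hh x, Ne.symm hx]
  have hF' (h : α → α) (p : α × Bool) : F h p ≠ p := by
    obtain ⟨x, b⟩ := p
    by_cases hx : h x = x <;> simp [F, hx]
  obtain ⟨c, h1, h2⟩ := exists_coloring_of_fixedPointFree (hF hf).toPerm (hF hg).toPerm
    (hF hf) (hF hg) (hF' f) (hF' g)
  refine ⟨fun x => c (x, true), fun x hx => ?_, fun x hx => ?_⟩
  · simpa [F, hx] using h1 (x, true)
  · simpa [F, hx] using h2 (x, true)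

/-- The points of a finite set can be paired up so that every member of a given laminar family
contains at most one point that is not paired inside that member. -/
theorem exists_involutive_of_laminar {α : Type*} [DecidableEq α] (𝒜 : Set (Finset α))
    (hlam : ∀ P ∈ 𝒜, ∀ Q ∈ 𝒜, P ⊆ Q ∨ Q ⊆ P ∨ P ∩ Q = ∅) (T : Finset α) :
    ∃ f : α → α, Function.Involutive f ∧ (∀ x ∉ T, f x = x) ∧
      ∀ P ∈ 𝒜, ∀ x ∈ P ∩ T, ∀ y ∈ P ∩ T,
        (f x ∉ P ∨ f x = x) → (f y ∉ P ∨ f y = y) → x = y := by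
  induction T using Finset.strongInduction with
  | H T ih =>
  by_cases hT : ∀ P ∈ 𝒜, (P ∩ T).card ≤ 1
  · exact ⟨id, fun _ => rfl, fun _ _ => rfl, fun P hP x hx y hy _ _ =>
      Finset.card_le_one.1 (hT P hP) x hx y hy⟩
  push Not at hT
  obtain ⟨P, ⟨hP, hPT⟩, hmin⟩ := (measure Finset.card).wf.has_min
    {P | P ∈ 𝒜 ∧ 1 < (P ∩ T).card} hT
  obtain ⟨a, ha, b, hb, hab⟩ := Finset.one_lt_card.1 hPT
  rw [Finset.mem_inter] at ha hb
  obtain ⟨f, hf, hfT, hfP⟩ := ih (T \ {a, b})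
    (Finset.ssubset_iff_subset_ne.2 ⟨Finset.sdiff_subset, fun h => by
      have := h ▸ ha.2
      simp at this⟩)
  have hfa : f a = a := hfT a (by simp)
  have hfb : f b = b := hfT b (by simp)
  have hxa (x : α) : f x = a ↔ x = a := by rw [hf.eq_iff, hfa]
  have hxb (x : α) : f x = b ↔ x = b := by rw [hf.eq_iff, hfb]
  refine ⟨fun x => if x = a then b else if x = b then a else f x, fun x => ?_, fun x hx => ?_, ?_⟩
  · have := hf x
    grind
  · have := hfT x
    grind
  · intro Q hQ x hx y hy hx' hy'
    by_cases hQT : 1 < (Q ∩ T).card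
    · have hQP : a ∈ Q ↔ b ∈ Q := by
        rcases hlam P hP Q hQ with h | h | h
        · exact iff_of_true (h ha.1) (h hb.1)
        · have := Finset.eq_of_subset_of_card_le h (not_lt.1 (hmin Q ⟨hQ, hQT⟩))
          subst this
          exact iff_of_true ha.1 hb.1
        · have h1 (z : α) (hz : z ∈ P) : z ∉ Q := fun hz' => by
            have : z ∈ P ∩ Q := Finset.mem_inter.2 ⟨hz, hz'⟩
            simp [h] at this
          exact iff_of_false (h1 a ha.1) (h1 b hb.1)
      have := hfP Q hQ x
      have := hfP Q hQ y
      grind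
    · exact Finset.card_le_one.1 (not_lt.1 hQT) x hx y hy

/-- If an involution reverses a two-colouring and moves all but at most one point of `U` within
`U`, then the colour classes on `U` differ in size by at most one. -/
theorem card_filter_le_card_filter_not_add_one {α : Type*} {U : Finset α} {f : α → α}
    (hf : Function.Involutive f) {c : α → Prop} [DecidablePred c]
    (hc : ∀ x, f x ≠ x → (c (f x) ↔ ¬ c x))
    (hU : ∀ x ∈ U, ∀ y ∈ U, (f x ∉ U ∨ f x = x) → (f y ∉ U ∨ f y = y) → x = y) :
    (U.filter c).card ≤ (U.filter fun x => ¬ c x).card + 1 ∧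
      (U.filter fun x => ¬ c x).card ≤ (U.filter c).card + 1 := by
  classical
  let B := U.filter fun x => f x ∉ U ∨ f x = x
  have hB : B.card ≤ 1 := Finset.card_le_one.2 fun x hx y hy => by
    simp only [B, Finset.mem_filter] at hx hy
    exact hU x hx.1 y hy.1 hx.2 hy.2
  have h1 : (U.filter c \ B).card ≤ (U.filter fun x => ¬ c x).card :=
    Finset.card_le_card_of_injOn f (fun x hx => by have := hc x; simp [B] at hx ⊢; grind)
      hf.injective.injOn
  have h2 : ((U.filter fun x => ¬ c x) \ B).card ≤ (U.filter c).card :=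
    Finset.card_le_card_of_injOn f (fun x hx => by have := hc x; simp [B] at hx ⊢; grind)
      hf.injective.injOn
  have h3 := Finset.le_card_sdiff B (U.filter c)
  have h4 := Finset.le_card_sdiff B (U.filter fun x => ¬ c x)
  omega

/-- Two laminar families have a two-colouring that is balanced on the trace on `T` of each of
their members. -/
theorem exists_balanced_coloring {α : Type*} [DecidableEq α] (𝒜 ℬ : Set (Finset α))
    (hAlam : ∀ P ∈ 𝒜, ∀ Q ∈ 𝒜, P ⊆ Q ∨ Q ⊆ P ∨ P ∩ Q = ∅)
    (hBlam : ∀ P ∈ ℬ, ∀ Q ∈ ℬ, P ⊆ Q ∨ Q ⊆ P ∨ P ∩ Q = ∅) (T : Finset α) :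
    ∃ c : α → Bool, ∀ P ∈ 𝒜 ∪ ℬ,
      ((P ∩ T).filter fun x => c x).card ≤ ((P ∩ T).filter fun x => ¬ c x).card + 1 ∧
      ((P ∩ T).filter fun x => ¬ c x).card ≤ ((P ∩ T).filter fun x => c x).card + 1 := by
  classical
  obtain ⟨f, hf, hfT, hfP⟩ := exists_involutive_of_laminar 𝒜 hAlam T
  obtain ⟨g, hg, hgT, hgP⟩ := exists_involutive_of_laminar ℬ hBlam T
  obtain ⟨c, hcf, hcg⟩ := exists_coloring_of_involutive hf hg
  have hmaps {h : α → α} (hh : Function.Involutive h) (hT : ∀ x ∉ T, h x = x) (x : α)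
      (hx : x ∈ T) : h x ∈ T := by
    by_contra hx'
    have := hT _ hx'
    rw [hh x] at this
    exact hx' (this ▸ hx)
  refine ⟨fun x => decide (c x), ?_⟩
  simp only [decide_eq_true_eq]
  rintro P (hP | hP)
  · refine card_filter_le_card_filter_not_add_one hf hcf fun x hx y hy h1 h2 =>
      hfP P hP x hx y hy ?_ ?_
    · have := hmaps hf hfT x
      grind
    · have := hmaps hf hfT y
      grind
  · refine card_filter_le_card_filter_not_add_one hg hcg fun x hx y hy h1 h2 =>
      hgP P hP x hx y hy ?_ ?_
    · have := hmaps hg hgT x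
      grind
    · have := hmaps hg hgT y
      grind

/-- Recolouring two colour classes in a balanced way does not increase the sum of the squares of
the sizes, and decreases it if the two classes differed in size by at least two. -/
theorem sum_sq_le_of_balanced {ι : Type*} [Fintype ι] [DecidableEq ι] {u v : ι → ℕ} {i j : ι}
    (hij : i ≠ j) (huv : ∀ k, k ≠ i → k ≠ j → v k = u k) (hsum : v i + v j = u i + u j)
    (h1 : v i ≤ v j + 1) (h2 : v j ≤ v i + 1) :
    ∑ k, v k ^ 2 ≤ ∑ k, u k ^ 2 ∧ (u j + 2 ≤ u i → ∑ k, v k ^ 2 < ∑ k, u k ^ 2) := by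
  have hsplit (w : ι → ℕ) : ∑ k, w k ^ 2 =
      w i ^ 2 + (w j ^ 2 + ∑ k ∈ (Finset.univ.erase i).erase j, w k ^ 2) := by
    rw [Finset.add_sum_erase _ (fun k => w k ^ 2) (by simp [hij.symm]),
      Finset.add_sum_erase _ (fun k => w k ^ 2) (by simp)]
  have hrest : ∑ k ∈ (Finset.univ.erase i).erase j, v k ^ 2 =
      ∑ k ∈ (Finset.univ.erase i).erase j, u k ^ 2 :=
    Finset.sum_congr rfl fun k hk => by
      simp only [Finset.mem_erase] at hk
      rw [huv k hk.2.1 hk.1]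
  rw [hsplit u, hsplit v, hrest]
  generalize u i = a at *
  generalize u j = b at *
  generalize v i = a' at *
  generalize v j = b' at *
  have hcases : a' = b' ∨ a' = b' + 1 ∨ b' = a' + 1 := by omega
  zify at *
  have hsq : (a' + b' : ℤ) ^ 2 = (a + b) ^ 2 := by rw [hsum]
  have hd : ((a' : ℤ) - b') ^ 2 ≤ (a - b) ^ 2 := by
    by_cases hab : (a : ℤ) = b
    · have : (a' : ℤ) = b' := by omega
      simp [hab, this]
    · have : 1 ≤ ((a : ℤ) - b) ^ 2 := by
        have := sq_pos_of_ne_zero (sub_ne_zero.2 hab)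
        omega
      rcases hcases with h | h | h <;> rw [h] <;> ring_nf <;> nlinarith
  refine ⟨by nlinarith, fun hab => ?_⟩
  have : ((a' : ℤ) - b') ^ 2 ≤ 1 := by
    rcases hcases with h | h | h <;> rw [h] <;> ring_nf <;> norm_num
  nlinarith

/-- Two laminar families of subsets of a finite set have a colouring with any finite set of
colours that is equitable on each of their members. -/
theorem exists_equitable_coloring {α ι : Type*} [DecidableEq α] [Fintype ι] [DecidableEq ι]
    [Nonempty ι] (S : Finset α) (𝒜 ℬ : Set (Finset α))
    (hAS : ∀ P ∈ 𝒜, P ⊆ S) (hBS : ∀ P ∈ ℬ, P ⊆ S)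
    (hAlam : ∀ P ∈ 𝒜, ∀ Q ∈ 𝒜, P ⊆ Q ∨ Q ⊆ P ∨ P ∩ Q = ∅)
    (hBlam : ∀ P ∈ ℬ, ∀ Q ∈ ℬ, P ⊆ Q ∨ Q ⊆ P ∨ P ∩ Q = ∅) :
    ∃ c : α → ι, ∀ P ∈ 𝒜 ∪ ℬ, ∀ i j,
      (P.filter fun x => c x = i).card ≤ (P.filter fun x => c x = j).card + 1 := by
  classical
  let fam := S.powerset.filter (· ∈ 𝒜 ∪ ℬ)
  have hfam (P : Finset α) : P ∈ fam ↔ P ∈ 𝒜 ∪ ℬ := by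
    simp only [fam, Finset.mem_filter, Finset.mem_powerset, and_iff_right_iff_imp]
    rintro (h | h)
    exacts [hAS P h, hBS P h]
  let Φ (c : α → ι) : ℕ := ∑ P ∈ fam, ∑ i, (P.filter fun x => c x = i).card ^ 2
  obtain ⟨c, -, hmin⟩ := (measure Φ).wf.has_min Set.univ Set.univ_nonempty
  refine ⟨c, fun P hP i j => ?_⟩
  by_contra! hlt
  have hij : i ≠ j := by
    rintro rfl
    omega
  let T := S.filter fun x => c x = i ∨ c x = j
  obtain ⟨d, hd⟩ := exists_balanced_coloring 𝒜 ℬ hAlam hBlam T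
  let c' (x : α) : ι := if c x = i ∨ c x = j then if d x then i else j else c x
  have hstep (Q : Finset α) (hQ : Q ∈ fam) := by
    have hQS : Q ⊆ S := Finset.mem_powerset.1 (Finset.mem_filter.1 hQ).1
    have hi : Q.filter (fun x => c' x = i) = (Q ∩ T).filter fun x => d x := by
      ext x
      have := @hQS x
      simp only [c', T, Finset.mem_filter, Finset.mem_inter]
      grind
    have hj : Q.filter (fun x => c' x = j) = (Q ∩ T).filter fun x => ¬ d x := by
      ext x
      have := @hQS x
      simp only [c', T, Finset.mem_filter, Finset.mem_inter]
      grind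
    have hQT : (Q ∩ T).card =
        (Q.filter fun x => c x = i).card + (Q.filter fun x => c x = j).card := by
      rw [← Finset.card_union_of_disjoint]
      · congr 1
        ext x
        have := @hQS x
        simp only [T, Finset.mem_filter, Finset.mem_inter, Finset.mem_union]
        grind
      · exact Finset.disjoint_filter.2 fun x _ h h' => hij (h.symm.trans h')
    have hb := hd Q ((hfam Q).1 hQ)
    rw [← hi, ← hj] at hb
    refine sum_sq_le_of_balanced (u := fun k => (Q.filter fun x => c x = k).card)
      (v := fun k => (Q.filter fun x => c' x = k).card) hij (fun k hki hkj => ?_) ?_ hb.1 hb.2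
    · congr 1
      ext x
      simp only [c', Finset.mem_filter]
      grind
    · rw [hi, hj, ← hQT]
      exact Finset.card_filter_add_card_filter_not _
  exact hmin c' (Set.mem_univ _) (Finset.sum_lt_sum (fun Q hQ => (hstep Q hQ).1)
    ⟨P, (hfam P).2 hP, (hstep P ((hfam P).2 hP)).2 (by omega)⟩)

/-- **Lemma (Nash-Williams).** If `𝒜, ℬ` are two laminar families of subsets of
a finite set `S` and `n` is a positive integer, then there is a subset `A` of
`S` with `⌊|P| / n⌋ ≤ |A ∩ P| ≤ ⌈|P| / n⌉` for every `P ∈ 𝒜 ∪ ℬ`. -/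
theorem nash_williams_laminar {α : Type*} [DecidableEq α] (S : Finset α)
    (𝒜 ℬ : Set (Finset α))
    (hAS : ∀ P ∈ 𝒜, P ⊆ S) (hBS : ∀ P ∈ ℬ, P ⊆ S)
    (hAlam : ∀ P ∈ 𝒜, ∀ Q ∈ 𝒜, P ⊆ Q ∨ Q ⊆ P ∨ P ∩ Q = ∅)
    (hBlam : ∀ P ∈ ℬ, ∀ Q ∈ ℬ, P ⊆ Q ∨ Q ⊆ P ∨ P ∩ Q = ∅)
    (n : ℕ) (hn : 0 < n) :
    ∃ A : Finset α, A ⊆ S ∧ ∀ P ∈ 𝒜 ∪ ℬ,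
      ⌊(P.card : ℚ) / (n : ℚ)⌋ ≤ ((A ∩ P).card : ℤ) ∧
      ((A ∩ P).card : ℤ) ≤ ⌈(P.card : ℚ) / (n : ℚ)⌉ := by
  have : NeZero n := ⟨hn.ne'⟩
  obtain ⟨c, hc⟩ := exists_equitable_coloring (ι := Fin n) S 𝒜 ℬ hAS hBS hAlam hBlam
  refine ⟨S.filter fun x => c x = 0, Finset.filter_subset _ _, fun P hP => ?_⟩
  have hPS : P ⊆ S := hP.elim (hAS P) (hBS P)
  have hinter : S.filter (fun x => c x = 0) ∩ P = P.filter fun x => c x = 0 := by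
    rw [Finset.filter_inter, Finset.inter_eq_right.2 hPS]
  rw [hinter]
  have hcard : P.card = ∑ i, (P.filter fun x => c x = i).card :=
    Finset.card_eq_sum_card_fiberwise fun _ _ => Finset.mem_coe.2 (Finset.mem_univ _)
  set a := (P.filter fun x => c x = 0).card with ha
  have hupper : P.card < n * (a + 1) := by
    rw [hcard]
    calc _ < ∑ _i : Fin n, (a + 1) :=
          Finset.sum_lt_sum (fun i _ => hc P hP i 0) ⟨0, Finset.mem_univ _, Nat.lt_succ_self a⟩
      _ = n * (a + 1) := by simp
  have hlower : n * a < P.card + n := by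
    rw [hcard]
    calc n * a = ∑ _i : Fin n, a := by simp
      _ < ∑ i, ((P.filter fun x => c x = i).card + 1) :=
          Finset.sum_lt_sum (fun i _ => hc P hP 0 i) ⟨0, Finset.mem_univ _, Nat.lt_succ_self a⟩
      _ = _ := by simp [Finset.sum_add_distrib]
  have hn' : (0 : ℚ) < n := Nat.cast_pos.2 hn
  constructor
  · rw [← Int.lt_add_one_iff, Int.floor_lt, div_lt_iff₀ hn']
    push_cast
    rw [mul_comm]
    exact_mod_cast hupper
  · rw [← Int.sub_one_lt_iff, Int.lt_ceil, lt_div_iff₀ hn']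
    have : (n * a : ℚ) < P.card + n := by exact_mod_cast hlower
    push_cast
    linarith
end
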